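/- For every integer n ≥ 0: C(0,8;4n+1) + C(1,8;4n+1) = C(3,8;4n+1) + C(4,8;4n+1) = N(1,8;4n+1) + N(2,8;4n+1) = N(3,8;4n+1) + N(4,8;4n+1). -/

import Mathlib

/-- The rank of a partition: its largest part minus its number of parts. -/
def partitionRank {n : ℕ} (π : n.Partition) : ℤ :=
  (π.parts.sup : ℤ) - π.parts.card

/-- The crank of a partition: the largest part if there are no parts equal to 1,
otherwise the number of parts larger than the number of ones minus the number of ones. -/
def partitionCrank {n : ℕ} (π : n.Partition) : ℤ :=
  if π.parts.count 1 = 0 then (π.parts.sup : ℤ)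
  else ((π.parts.filter (fun x => π.parts.count 1 < x)).card : ℤ) - π.parts.count 1

/-- `N(a,M;n)`: the number of partitions of `n` whose rank is congruent to `a` modulo `M`. -/
def rankCount (a : ℤ) (M : ℕ) (n : ℕ) : ℕ :=
  (Finset.univ.filter (fun π : n.Partition => partitionRank π % M = a % M)).card

/-- `C(a,M;n)`: the number of partitions of `n` whose crank is congruent to `a` modulo `M`. -/
def crankCount (a : ℤ) (M : ℕ) (n : ℕ) : ℕ :=
  (Finset.univ.filter (fun π : n.Partition => partitionCrank π % M = a % M)).card

/-- parts of the image of the Dyson map -/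
lemma sup_mem_of_ne_zero (s : Multiset ℕ) (h : s ≠ 0) : s.sup ∈ s := by
  induction s using Multiset.induction_on with
  | empty => exact absurd rfl h
  | cons a t ih =>
    rw [Multiset.sup_cons]
    by_cases ht : t = 0
    · subst ht; simp
    · rcases le_total a t.sup with h1 | h1
      · rw [sup_eq_right.mpr h1]; exact Multiset.mem_cons_of_mem (ih ht)
      · rw [sup_eq_left.mpr h1]; exact Multiset.mem_cons_self _ _

lemma sum_map_pred (s : Multiset ℕ) (h : ∀ x ∈ s, 0 < x) :
    (s.map (fun x => x - 1)).sum + s.card = s.sum := by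
  induction s using Multiset.induction_on with
  | empty => simp
  | cons a t ih =>
    have h1 := ih (fun x hx => h x (Multiset.mem_cons_of_mem hx))
    have h2 := h a (Multiset.mem_cons_self _ _)
    simp only [Multiset.map_cons, Multiset.sum_cons, Multiset.card_cons]
    omega

lemma sum_filter_ne_zero (s : Multiset ℕ) : (s.filter (fun x => x ≠ 0)).sum = s.sum := by
  induction s using Multiset.induction_on with
  | empty => simp
  | cons a t ih =>
    by_cases h : a = 0
    · subst h; simp [ih]
    · rw [Multiset.filter_cons_of_pos (p := fun x => x ≠ 0) _ h]; simp [ih]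

lemma map_succ_pred (s : Multiset ℕ) (h : ∀ x ∈ s, 0 < x) :
    ((s.map (fun x => x - 1)).filter (fun x => x ≠ 0)).map (fun x => x + 1)
      + Multiset.replicate (s.card - ((s.map (fun x => x - 1)).filter (fun x => x ≠ 0)).card) 1 = s := by
  induction s using Multiset.induction_on with
  | empty => simp
  | cons a t ih =>
    have h1 := ih (fun x hx => h x (Multiset.mem_cons_of_mem hx))
    have h2 := h a (Multiset.mem_cons_self _ _)
    have h3 : ((t.map (fun x => x - 1)).filter (fun x => x ≠ 0)).card ≤ t.card := by
      calc _ ≤ (t.map (fun x => x - 1)).card := Multiset.card_le_card (Multiset.filter_le _ _)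
        _ = _ := by simp
    simp only [Multiset.map_cons]
    by_cases h4 : a - 1 = 0
    · rw [Multiset.filter_cons_of_neg _ (by simpa using h4), Multiset.card_cons,
        Nat.succ_sub h3, Multiset.replicate_succ, Multiset.add_cons, h1]
      congr 1; omega
    · rw [Multiset.filter_cons_of_pos (p := fun x => x ≠ 0) _ h4, Multiset.card_cons, Multiset.card_cons,
        Multiset.map_cons, Nat.add_sub_add_right, Multiset.cons_add, h1]
      congr 1; omega

/-- forward map -/
def dysonFwd (m k : ℕ) (p : (k + m + 1).Partition) (h : (m : ℤ) ≤ partitionRank p) :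
    k.Partition where
  parts := (p.parts.erase p.parts.sup).map (fun x => x + 1) +
    Multiset.replicate (p.parts.sup - m - 1 - (p.parts.erase p.parts.sup).card) 1
  parts_pos := by
    intro i hi
    rw [Multiset.mem_add] at hi
    rcases hi with hi | hi
    · simp only [Multiset.mem_map] at hi
      obtain ⟨a, _, rfl⟩ := hi; omega
    · rw [Multiset.eq_of_mem_replicate hi]; omega
  parts_sum := by
    have hne : p.parts ≠ 0 := by
      intro h0; have := p.parts_sum; rw [h0] at this; simp at this
    have hm := sup_mem_of_ne_zero _ hne
    have e1 : p.parts.sup + (p.parts.erase p.parts.sup).sum = k + m + 1 := by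
      conv_rhs => rw [← p.parts_sum]
      rw [← Multiset.sum_cons, Multiset.cons_erase hm]
    have e2 : (p.parts.erase p.parts.sup).card + 1 = p.parts.card := by
      rw [← Multiset.card_cons _ (p.parts.erase _), Multiset.cons_erase hm]
    unfold partitionRank at h
    rw [Multiset.sum_add, Multiset.sum_map_add]
    simp
    omega

/-- backward map -/
def dysonBwd (m k : ℕ) (p : k.Partition) : (k + m + 1).Partition where
  parts := (p.parts.card + m + 1) ::ₘ (p.parts.map (fun x => x - 1)).filter (fun x => x ≠ 0)
  parts_pos := by
    intro i hi
    rw [Multiset.mem_cons] at hi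
    rcases hi with hi | hi
    · omega
    · rw [Multiset.mem_filter] at hi; omega
  parts_sum := by
    rw [Multiset.sum_cons, sum_filter_ne_zero]
    have := sum_map_pred p.parts (fun x hx => p.parts_pos hx)
    rw [p.parts_sum] at this; omega

lemma dyson_card (m k : ℕ) :
    (Finset.univ.filter (fun p : (k + m + 1).Partition => (m : ℤ) ≤ partitionRank p)).card =
    (Finset.univ.filter (fun p : k.Partition => partitionRank p ≤ (m : ℤ) + 2)).card := by
  refine Finset.card_bij' (fun p hp => dysonFwd m k p (by simpa using hp))
    (fun p _ => dysonBwd m k p) ?_ ?_ ?_ ?_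
  · intro p hp
    have h : (m : ℤ) ≤ partitionRank p := by simpa using hp
    have hne : p.parts ≠ 0 := by
      intro h0; have := p.parts_sum; rw [h0] at this; simp at this
    have hm := sup_mem_of_ne_zero _ hne
    have e2 : (p.parts.erase p.parts.sup).card + 1 = p.parts.card := by
      rw [← Multiset.card_cons _ (p.parts.erase _), Multiset.cons_erase hm]
    unfold partitionRank at h
    have e3 : (dysonFwd m k p (by simpa using hp)).parts.sup ≤ p.parts.sup + 1 := by
      rw [Multiset.sup_le]
      intro b hb
      simp only [dysonFwd, Multiset.mem_add, Multiset.mem_map] at hb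
      rcases hb with ⟨a, ha, rfl⟩ | hb
      · have := Multiset.le_sup (Multiset.mem_of_mem_erase ha); omega
      · rw [Multiset.eq_of_mem_replicate hb]; omega
    have e4 : (dysonFwd m k p (by simpa using hp)).parts.card = p.parts.sup - m - 1 := by
      simp only [dysonFwd, Multiset.card_add, Multiset.card_map, Multiset.card_replicate]
      omega
    simp only [Finset.mem_filter, Finset.mem_univ, true_and]
    rw [partitionRank, e4]
    omega
  · intro p hp
    have h : partitionRank p ≤ (m : ℤ) + 2 := by simpa using hp
    unfold partitionRank at h
    simp only [Finset.mem_filter, Finset.mem_univ, true_and]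
    unfold partitionRank
    have e1 : p.parts.card + m + 1 ≤ (dysonBwd m k p).parts.sup :=
      Multiset.le_sup (Multiset.mem_cons_self _ _)
    have e2 : (dysonBwd m k p).parts.card ≤ p.parts.card + 1 := by
      simp only [dysonBwd, Multiset.card_cons]
      have := Multiset.card_le_card (Multiset.filter_le (fun x => x ≠ 0)
        (p.parts.map (fun x => x - 1)))
      simp at this ⊢; omega
    omega
  · intro p hp
    have h : (m : ℤ) ≤ partitionRank p := by simpa using hp
    have hne : p.parts ≠ 0 := by
      intro h0; have := p.parts_sum; rw [h0] at this; simp at this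
    have hm := sup_mem_of_ne_zero _ hne
    have e2 : (p.parts.erase p.parts.sup).card + 1 = p.parts.card := by
      rw [← Multiset.card_cons _ (p.parts.erase _), Multiset.cons_erase hm]
    unfold partitionRank at h
    apply Nat.Partition.ext
    simp only [dysonFwd, dysonBwd, Multiset.card_add, Multiset.card_map, Multiset.card_replicate,
      Multiset.map_add, Multiset.map_map, Multiset.map_replicate, Multiset.filter_add]
    have e5 : p.parts.erase p.parts.sup =
      (Multiset.map ((fun x => x - 1) ∘ fun x => x + 1) (p.parts.erase p.parts.sup)) := by
      simp
    rw [← e5, Multiset.filter_eq_self.mpr, Multiset.filter_eq_nil.mpr, add_zero]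
    · conv_rhs => rw [← Multiset.cons_erase hm]
      congr 1; omega
    · intro a ha; rw [Multiset.eq_of_mem_replicate ha]; simp
    · intro a ha; have := p.parts_pos (Multiset.mem_of_mem_erase ha); omega
  · intro p hp
    have h : partitionRank p ≤ (m : ℤ) + 2 := by simpa using hp
    unfold partitionRank at h
    have e1 : (dysonBwd m k p).parts.sup = p.parts.card + m + 1 := by
      apply le_antisymm
      · rw [Multiset.sup_le]
        intro b hb
        simp only [dysonBwd, Multiset.mem_cons, Multiset.mem_filter, Multiset.mem_map] at hb
        rcases hb with rfl | ⟨⟨a, ha, rfl⟩, _⟩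
        · exact le_rfl
        · have := Multiset.le_sup ha; omega
      · exact Multiset.le_sup (Multiset.mem_cons_self _ _)
    have e2 : (dysonBwd m k p).parts.erase (p.parts.card + m + 1) =
      (p.parts.map (fun x => x - 1)).filter (fun x => x ≠ 0) := by
      simp only [dysonBwd, Multiset.erase_cons_head]
    apply Nat.Partition.ext
    simp only [dysonFwd]
    rw [e1, e2]
    have := map_succ_pred p.parts (fun x hx => p.parts_pos hx)
    conv_rhs => rw [← this]
    congr 2; omega

lemma young_sum_rowLens (μ : YoungDiagram) : μ.rowLens.sum = μ.cells.card := by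
  have h : μ.cells.card = ∑ i ∈ Finset.range (μ.colLen 0), μ.rowLen i := by
    rw [Finset.card_eq_sum_card_fiberwise (f := Prod.fst) (t := Finset.range (μ.colLen 0))]
    · apply Finset.sum_congr rfl
      intro i _
      rw [YoungDiagram.rowLen_eq_card]
      rfl
    · intro c hc
      have hc : c ∈ μ := hc
      simp only [Finset.coe_range, Set.mem_Iio]
      rw [← YoungDiagram.mem_iff_lt_colLen]
      exact μ.up_left_mem le_rfl (Nat.zero_le _) hc
  rw [h, YoungDiagram.rowLens]
  rfl

lemma young_sup_rowLens (μ : YoungDiagram) : (μ.rowLens : Multiset ℕ).sup = μ.rowLen 0 := by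
  apply le_antisymm
  · rw [Multiset.sup_le]
    intro b hb
    simp only [YoungDiagram.rowLens, Multiset.mem_coe, List.mem_map, List.mem_range] at hb
    obtain ⟨i, _, rfl⟩ := hb
    exact μ.rowLen_anti _ _ (Nat.zero_le _)
  · by_cases h : 0 < μ.colLen 0
    · apply Multiset.le_sup
      simp only [YoungDiagram.rowLens, Multiset.mem_coe, List.mem_map, List.mem_range]
      exact ⟨0, h, rfl⟩
    · have : ¬ 0 < μ.rowLen 0 := by
        rw [← YoungDiagram.mem_iff_lt_rowLen, YoungDiagram.mem_iff_lt_colLen]; exact h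
      omega

/-- partition to diagram -/
def toYoung {n : ℕ} (p : n.Partition) : YoungDiagram :=
  YoungDiagram.ofRowLens (p.parts.sort (· ≥ ·)) (by
    have := Multiset.pairwise_sort p.parts (· ≥ ·)
    exact this.sortedGE)

lemma toYoung_rowLens {n : ℕ} (p : n.Partition) :
    ((toYoung p).rowLens : Multiset ℕ) = p.parts := by
  unfold toYoung
  rw [YoungDiagram.rowLens_ofRowLens_eq_self]
  · exact Multiset.sort_eq _ _
  · intro x hx
    exact p.parts_pos ((Multiset.mem_sort _).mp hx)

lemma toYoung_card {n : ℕ} (p : n.Partition) : (toYoung p).cells.card = n := by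
  rw [← young_sum_rowLens, ← Multiset.sum_coe, toYoung_rowLens, p.parts_sum]

lemma toYoung_rowLens_eq {n : ℕ} (p : n.Partition) (μ : YoungDiagram)
    (h : (μ.rowLens : Multiset ℕ) = p.parts) : toYoung p = μ := by
  have h1 : (toYoung p).rowLens = μ.rowLens := by
    apply List.Perm.eq_of_sortedGE (YoungDiagram.rowLens_sorted _) (YoungDiagram.rowLens_sorted _)
    rw [← Multiset.coe_eq_coe, toYoung_rowLens, h]
  apply YoungDiagram.equivListRowLens.injective
  apply Subtype.ext
  exact h1

/-- conjugate partition -/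
def conjPart {n : ℕ} (p : n.Partition) : n.Partition where
  parts := ((toYoung p).transpose.rowLens : Multiset ℕ)
  parts_pos := by
    intro i hi
    exact YoungDiagram.pos_of_mem_rowLens _ _ (by simpa using hi)
  parts_sum := by
    rw [Multiset.sum_coe, young_sum_rowLens]
    have : (toYoung p).transpose.cells.card = (toYoung p).cells.card := by
      simp [YoungDiagram.transpose]
    rw [this, toYoung_card]

lemma conjPart_conjPart {n : ℕ} (p : n.Partition) : conjPart (conjPart p) = p := by
  have h : toYoung (conjPart p) = (toYoung p).transpose := toYoung_rowLens_eq _ _ rfl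
  apply Nat.Partition.ext
  change ((toYoung (conjPart p)).transpose.rowLens : Multiset ℕ) = _
  rw [h, YoungDiagram.transpose_transpose, toYoung_rowLens]

lemma rank_young {n : ℕ} (p : n.Partition) :
    partitionRank p = (toYoung p).rowLen 0 - (toYoung p).colLen 0 := by
  unfold partitionRank
  rw [← toYoung_rowLens p, young_sup_rowLens, Multiset.coe_card, YoungDiagram.length_rowLens]

lemma rank_conj {n : ℕ} (p : n.Partition) : partitionRank (conjPart p) = - partitionRank p := by
  have h : toYoung (conjPart p) = (toYoung p).transpose := toYoung_rowLens_eq _ _ rfl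
  rw [rank_young, rank_young, h, YoungDiagram.rowLen_transpose, YoungDiagram.colLen_transpose]
  ring

lemma card_conj {n : ℕ} (P Q : ℤ → Prop) [DecidablePred P] [DecidablePred Q]
    (h : ∀ x, P x ↔ Q (-x)) :
    (Finset.univ.filter (fun p : n.Partition => P (partitionRank p))).card =
    (Finset.univ.filter (fun p : n.Partition => Q (partitionRank p))).card := by
  refine Finset.card_bij' (fun p _ => conjPart p) (fun p _ => conjPart p) ?_ ?_ ?_ ?_
  · intro p hp
    simp only [Finset.mem_filter, Finset.mem_univ, true_and] at hp ⊢
    rw [rank_conj]; exact (h _).mp hp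
  · intro p hp
    simp only [Finset.mem_filter, Finset.mem_univ, true_and] at hp ⊢
    rw [rank_conj, h]; simpa using hp
  · intro p _; exact conjPart_conjPart p
  · intro p _; exact conjPart_conjPart p

open Finset in
lemma rank_bounds {n : ℕ} (hn : 1 ≤ n) (p : n.Partition) :
    partitionRank p < n ∧ -(n : ℤ) < partitionRank p := by
  have key : ∀ q : n.Partition, partitionRank q < n := by
    intro q
    have hne : q.parts ≠ 0 := by
      intro h0; have := q.parts_sum; rw [h0] at this; simp at this; omega
    have h1 : q.parts.sup ≤ n := by
      rw [Multiset.sup_le]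
      intro b hb
      have := Multiset.le_sum_of_mem hb
      rw [q.parts_sum] at this; exact this
    have h2 : 0 < q.parts.card := Multiset.card_pos.mpr hne
    unfold partitionRank; omega
  have h1 := key p
  have h2 := key (conjPart p)
  rw [rank_conj] at h2
  constructor <;> omega

/-- number of partitions, extended to the integers -/
def pp (n : ℤ) : ℤ := if 0 ≤ n then Fintype.card (n.toNat.Partition) else 0
/-- number of partitions of a positive integer -/
def pq (n : ℤ) : ℤ := if 1 ≤ n then pp n else 0
/-- number of partitions with rank at least m -/
def uu (m n : ℤ) : ℤ := if 1 ≤ n then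
  (Finset.univ.filter (fun p : n.toNat.Partition => m ≤ partitionRank p)).card else 0
/-- rank residue counts -/
def rr (a n : ℤ) : ℤ := if 1 ≤ n then rankCount a 8 n.toNat else 0

lemma uu_nonpos (m : ℤ) {n : ℤ} (h : n ≤ 0) : uu m n = 0 := by
  unfold uu; rw [if_neg (by omega)]

lemma rr_nonpos (m : ℤ) {n : ℤ} (h : n ≤ 0) : rr m n = 0 := by
  unfold rr; rw [if_neg (by omega)]

lemma uu_large {m n : ℤ} (h : n ≤ m) : uu m n = 0 := by
  unfold uu
  split_ifs with h1
  · rw [Nat.cast_eq_zero, Finset.card_eq_zero, Finset.filter_eq_empty_iff]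
    intro p _
    have := (rank_bounds (by omega) p).1
    omega
  · rfl

lemma uu_small {m n : ℤ} (h : m ≤ -n) : uu m n = pq n := by
  unfold uu pq pp
  split_ifs with h1 h2
  · rw [Finset.filter_true_of_mem]
    · simp
    intro p _
    have := (rank_bounds (by omega) p).2
    omega
  · omega
  · rfl

lemma uu_C2 (m n : ℤ) : uu m n + uu (1 - m) n = pq n := by
  unfold uu pq pp
  split_ifs with h1 h2
  · have h3 := card_conj (n := n.toNat) (fun x => 1 - m ≤ x) (fun x => ¬ (m ≤ x))
      (by intro x; omega)
    rw [h3, ← Nat.cast_add, Finset.card_filter_add_card_filter_not]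
    simp
  · omega
  · rfl

lemma uu_C1 {m : ℤ} (hm : 0 ≤ m) (n : ℤ) :
    uu m n + uu (m + 3) (n - m - 1) = pp (n - m - 1) := by
  by_cases h : n < m + 1
  · rw [uu_large (by omega), uu_nonpos _ (by omega)]
    unfold pp; rw [if_neg (by omega)]; rfl
  · obtain ⟨a, rfl⟩ := Int.eq_ofNat_of_zero_le hm
    obtain ⟨k, hk⟩ := Int.eq_ofNat_of_zero_le (show 0 ≤ n - a - 1 by omega)
    have hn : n = ((k + a + 1 : ℕ) : ℤ) := by push_cast; omega
    rw [hk, hn]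
    have h1 := dyson_card a k
    have h2 := Finset.card_filter_add_card_filter_not (s := Finset.univ)
      (fun p : k.Partition => partitionRank p ≤ (a : ℤ) + 2)
    have h3 : (Finset.univ.filter (fun p : k.Partition => ¬ partitionRank p ≤ (a : ℤ) + 2))
      = Finset.univ.filter (fun p : k.Partition => (a : ℤ) + 3 ≤ partitionRank p) := by
      apply Finset.filter_congr; intro p _; omega
    have h4 : uu ((a : ℤ) + 3) k =
       (Finset.univ.filter (fun p : k.Partition => (a : ℤ) + 3 ≤ partitionRank p)).card := by
      unfold uu
      split_ifs with h
      · simp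
      · have : k = 0 := by omega
        subst this
        symm
        rw [Nat.cast_eq_zero, Finset.card_eq_zero, Finset.filter_eq_empty_iff]
        intro p _
        have hp : p.parts = 0 := by
          have := p.parts_sum
          rw [Multiset.sum_eq_zero_iff] at this
          apply Multiset.eq_zero_of_forall_notMem
          intro x hx
          have h5 := this x hx
          have := p.parts_pos hx
          omega
        unfold partitionRank
        rw [hp]; simp; omega
    rw [h4]
    unfold uu pp
    rw [if_pos (by omega), if_pos (by omega)]
    simp only [Int.toNat_natCast]
    rw [h1, ← h3, ← Nat.cast_add, h2]
    simp

lemma uu_C (m n : ℤ) : uu m n + uu (m + 3) (n - m - 1) = pp (n - m - 1)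
    - (if m < 0 ∧ n = 0 then 1 else 0) - (if m < -1 ∧ n = m + 1 then 1 else 0) := by
  have hp : ∀ x, pq x = pp x - (if x = 0 then 1 else 0) := by
    intro x
    unfold pq
    split_ifs with h1 h2 h2
    · omega
    · ring
    · subst h2; simp [pp]
    · unfold pp; rw [if_neg (by omega)]; rfl
  rcases lt_trichotomy m (-1) with h | h | h
  · have h1 := uu_C1 (m := -m - 2) (by omega) (n - m - 1)
    have h2 := uu_C2 m n
    have h3 := uu_C2 (m + 3) (n - m - 1)
    rw [hp] at h2 h3
    rw [show -m - 2 + 3 = 1 - m by ring, show n - m - 1 - (-m - 2) - 1 = n by ring] at h1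
    rw [show 1 - (m + 3) = -m - 2 by ring] at h3
    have e1 : (if m < 0 ∧ n = 0 then (1 : ℤ) else 0) = if n = 0 then 1 else 0 := by
      apply if_congr _ rfl rfl; omega
    have e2 : (if m < -1 ∧ n = m + 1 then (1 : ℤ) else 0) = if n - m - 1 = 0 then 1 else 0 := by
      apply if_congr _ rfl rfl; omega
    rw [e1, e2]; linarith
  · subst h
    have h2 := uu_C2 (-1) n
    rw [hp] at h2
    norm_num at h2 ⊢
    linarith
  · rw [uu_C1 (by omega), if_neg (by omega), if_neg (by omega)]; ring

/-- sign -/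
def sg (j : ℤ) : ℤ := if j % 2 = 0 then 1 else -1

lemma sg_add_one (j : ℤ) : sg (j + 1) = - sg j := by
  unfold sg; split_ifs <;> omega

lemma sg_one_sub (j : ℤ) : sg (1 - j) = - sg j := by
  unfold sg; split_ifs <;> omega

/-- the quadratic exponent c j (j-1) bounds j -/
lemma quad_bound {c n j : ℤ} (hc : 0 < c) (h : c * (j * (j - 1)) ≤ n) :
    -|n| ≤ j ∧ j ≤ |n| + 1 := by
  have h0 : 0 ≤ j * (j - 1) := by
    rcases le_or_gt j 0 with h | h
    · nlinarith
    · exact mul_nonneg (by omega) (by omega)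
  have h1 : j * (j - 1) ≤ |n| := by
    have := le_abs_self n
    nlinarith
  have h2 := abs_nonneg n
  constructor
  · by_contra hh
    push Not at hh
    nlinarith
  · by_contra hh
    push Not at hh
    nlinarith

lemma fin_supp {c : ℤ} (hc : 0 < c) (n : ℤ) (f : ℤ → ℤ)
    (h : ∀ j, f j ≠ 0 → c * (j * (j - 1)) ≤ n) : (Function.support f).Finite := by
  apply (Set.finite_Icc (-|n|) (|n| + 1)).subset
  intro j hj
  exact quad_bound hc (h j hj)

lemma finsum_anti (f : ℤ → ℤ) (h : ∀ j, f (1 - j) = - f j) : ∑ᶠ j, f j = 0 := by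
  have h1 : ∑ᶠ j, f ((Equiv.subLeft 1) j) = ∑ᶠ j, f j := finsum_comp_equiv (Equiv.subLeft (1 : ℤ))
  have h2 : ∑ᶠ j, f ((Equiv.subLeft 1) j) = - ∑ᶠ j, f j := by
    rw [← finsum_neg_distrib]
    apply finsum_congr; intro j; exact h j
  omega

/-- the alternating sums -/
noncomputable def al (c k n : ℤ) : ℤ :=
  ∑ᶠ j : ℤ, sg j * uu (k - 2 * c * j) (n - c * (j * (j - 1)))

/-- the partial theta -/
noncomputable def si (c J n : ℤ) : ℤ :=
  ∑ᶠ j : ℤ, if J ≤ j ∧ n = c * (j * (j - 1)) then sg j else 0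

lemma al_fin {c : ℤ} (hc : 0 < c) (k n : ℤ) :
    (Function.support fun j : ℤ => sg j * uu (k - 2 * c * j) (n - c * (j * (j - 1)))).Finite := by
  apply fin_supp hc n
  intro j hj
  by_contra hh
  apply hj
  rw [uu_nonpos _ (by omega), mul_zero]

lemma si_fin {c : ℤ} (hc : 0 < c) (J n : ℤ) :
    (Function.support fun j : ℤ => if J ≤ j ∧ n = c * (j * (j - 1)) then sg j else 0).Finite := by
  apply fin_supp hc n
  intro j hj
  by_contra hh
  apply hj
  rw [if_neg]; omega

lemma al_rec {c : ℤ} (hc : 0 < c) (K n : ℤ) :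
    al c K n + si c (K / (2 * c) + 1) n =
      al c (K + 3 - 2 * c) (n - K + 2 * c - 1) + si c ((K + 1) / (2 * c)) (n - K + 2 * c - 1) := by
  have a1 : al c K n = ∑ᶠ j : ℤ, sg (j + 1) * uu (K - 2 * c * (j + 1)) (n - c * ((j + 1) * (j + 1 - 1))) :=
    (finsum_comp_equiv (f := fun j : ℤ => sg j * uu (K - 2 * c * j) (n - c * (j * (j - 1))))
      (Equiv.addRight (1 : ℤ))).symm
  have f1 : (Function.support fun j : ℤ => sg (j + 1) * uu (K - 2 * c * (j + 1)) (n - c * ((j + 1) * (j + 1 - 1)))).Finite :=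
    (al_fin hc K n).preimage (f := fun j => j + 1) (add_left_injective 1).injOn
  have a2 : si c (K / (2 * c) + 1) n = ∑ᶠ j : ℤ, if K / (2 * c) + 1 ≤ j + 1 ∧ n = c * ((j + 1) * (j + 1 - 1)) then sg (j + 1) else 0 :=
    (finsum_comp_equiv (f := fun j : ℤ => if K / (2 * c) + 1 ≤ j ∧ n = c * (j * (j - 1)) then sg j else 0)
      (Equiv.addRight (1 : ℤ))).symm
  have f2 : (Function.support fun j : ℤ => if K / (2 * c) + 1 ≤ j + 1 ∧ n = c * ((j + 1) * (j + 1 - 1)) then sg (j + 1) else 0).Finite :=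
    (si_fin hc (K / (2 * c) + 1) n).preimage (f := fun j => j + 1) (add_left_injective 1).injOn
  have z : ∑ᶠ j : ℤ, sg j * pp (n - K + 2 * c - 1 - c * (j * (j - 1))) = 0 := by
    apply finsum_anti
    intro j
    rw [sg_one_sub, show (1 - j) * (1 - j - 1) = j * (j - 1) by ring]; ring
  have f5 : (Function.support fun j : ℤ => sg j * pp (n - K + 2 * c - 1 - c * (j * (j - 1)))).Finite := by
    apply fin_supp hc (n - K + 2 * c - 1)
    intro j hj
    by_contra hh
    apply hj
    rw [pp, if_neg (by omega), mul_zero]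
  have f3 := al_fin hc (K + 3 - 2 * c) (n - K + 2 * c - 1)
  have f4 := si_fin hc ((K + 1) / (2 * c)) (n - K + 2 * c - 1)
  rw [← add_zero (al c (K + 3 - 2 * c) (n - K + 2 * c - 1) + _), ← neg_zero, ← z, a1, a2, al, si,
    ← finsum_neg_distrib,
    ← finsum_add_distrib f1 f2, ← finsum_add_distrib f3 f4, ← finsum_add_distrib]
  · apply finsum_congr
    intro j
    have h := uu_C (K - 2 * c * (j + 1)) (n - c * ((j + 1) * (j + 1 - 1)))
    have e1 : K - 2 * c * (j + 1) + 3 = K + 3 - 2 * c - 2 * c * j := by ring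
    have e2 : n - c * ((j + 1) * (j + 1 - 1)) - (K - 2 * c * (j + 1)) - 1 =
      n - K + 2 * c - 1 - c * (j * (j - 1)) := by ring
    rw [e1, e2] at h
    have h2c : 0 < 2 * c := by omega
    have c1 : (if K / (2 * c) + 1 ≤ j + 1 ∧ n = c * ((j + 1) * (j + 1 - 1)) then sg (j + 1) else 0)
      = sg (j + 1) * (if K - 2 * c * (j + 1) < 0 ∧ n - c * ((j + 1) * (j + 1 - 1)) = 0 then 1 else 0) := by
      rw [mul_ite, mul_one, mul_zero]
      apply if_congr _ rfl rfl
      apply and_congr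
      · rw [Int.add_one_le_iff, Int.ediv_lt_iff_lt_mul h2c, sub_neg, mul_comm]
      · omega
    have c2 : (if (K + 1) / (2 * c) ≤ j ∧ n - K + 2 * c - 1 = c * (j * (j - 1)) then sg j else 0)
      = sg j * (if K - 2 * c * (j + 1) < -1 ∧ n - c * ((j + 1) * (j + 1 - 1)) = K - 2 * c * (j + 1) + 1 then 1 else 0) := by
      rw [mul_ite, mul_one, mul_zero]
      apply if_congr _ rfl rfl
      apply and_congr
      · rw [← Int.lt_add_one_iff, Int.ediv_lt_iff_lt_mul h2c, mul_comm]; omega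
      · constructor <;> intro hh <;> linarith
    rw [c1, c2, sg_add_one]
    linear_combination (-sg j) * h
  · exact (f3.union f4).subset (Function.support_add _ _)
  · change (Function.support _).Finite
    rw [Function.support_fun_neg]; exact f5

lemma al_symm {c : ℤ} (hc : 0 < c) (k n : ℤ) : al c k n = al c (2 * c + 1 - k) n := by
  have a1 : al c k n = ∑ᶠ j : ℤ, sg (1 - j) * uu (k - 2 * c * (1 - j)) (n - c * ((1 - j) * (1 - j - 1))) :=
    (finsum_comp_equiv (f := fun j : ℤ => sg j * uu (k - 2 * c * j) (n - c * (j * (j - 1))))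
      (Equiv.subLeft (1 : ℤ))).symm
  have z : ∑ᶠ j : ℤ, sg j * pq (n - c * (j * (j - 1))) = 0 := by
    apply finsum_anti
    intro j
    rw [sg_one_sub, show (1 - j) * (1 - j - 1) = j * (j - 1) by ring]; ring
  have f5 : (Function.support fun j : ℤ => sg j * pq (n - c * (j * (j - 1)))).Finite := by
    apply fin_supp hc n
    intro j hj
    by_contra hh
    apply hj
    rw [pq, if_neg (by omega), mul_zero]
  rw [a1, ← add_zero (al c (2 * c + 1 - k) n), ← neg_zero, ← z, ← finsum_neg_distrib, al, ← finsum_add_distrib]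
  · apply finsum_congr
    intro j
    have h := uu_C2 (k - 2 * c * (1 - j)) (n - c * (j * (j - 1)))
    rw [sg_one_sub, show (1 - j) * (1 - j - 1) = j * (j - 1) by ring,
      show 2 * c + 1 - k - 2 * c * j = 1 - (k - 2 * c * (1 - j)) by ring]
    linear_combination (-sg j) * h
  · exact al_fin hc _ _
  · change (Function.support _).Finite
    rw [Function.support_fun_neg]; exact f5

lemma al_nonpos {c : ℤ} (hc : 0 < c) (k : ℤ) {n : ℤ} (h : n ≤ 0) : al c k n = 0 := by
  unfold al
  apply finsum_eq_zero_of_forall_eq_zero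
  intro j
  have h0 : 0 ≤ j * (j - 1) := by
    rcases le_or_gt j 0 with h | h
    · nlinarith
    · exact mul_nonneg (by omega) (by omega)
  rw [uu_nonpos _ (by nlinarith), mul_zero]

lemma al_large {c : ℤ} (hc : 0 < c) {k n : ℤ} (h : 2 * c * (|n| + 1) + |n| ≤ k) : al c k n = 0 := by
  unfold al
  apply finsum_eq_zero_of_forall_eq_zero
  intro j
  by_cases hj : c * (j * (j - 1)) ≤ n
  · have h1 := (quad_bound hc hj).2
    have h0 : 0 ≤ j * (j - 1) := by
      rcases le_or_gt j 0 with h | h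
      · nlinarith
      · exact mul_nonneg (by omega) (by omega)
    have h2 := le_abs_self n
    rw [uu_large, mul_zero]
    nlinarith
  · rw [uu_nonpos _ (by omega), mul_zero]

lemma si_odd {c J n : ℤ} (h : n % 2 = 1) : si c J n = 0 := by
  unfold si
  apply finsum_eq_zero_of_forall_eq_zero
  intro j
  rw [if_neg]
  rintro ⟨_, h1⟩
  have h2 : Even (j * (j - 1)) := Int.even_mul_pred_self j
  obtain ⟨r, hr⟩ := h2
  rw [hr] at h1
  have : n = 2 * (c * r) := by rw [h1]; ring
  omega

lemma si_nonpos {c J n : ℤ} (hc : 0 < c) (hJ : 2 ≤ J) (h : n ≤ 0) : si c J n = 0 := by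
  unfold si
  apply finsum_eq_zero_of_forall_eq_zero
  intro j
  rw [if_neg]
  rintro ⟨h0, h1⟩
  have : 0 < j * (j - 1) := mul_pos (by omega) (by omega)
  nlinarith

lemma si_succ {c : ℤ} (hc : 0 < c) (J n : ℤ) : si c J n = si c (J + 1) n +
    if n = c * (J * (J - 1)) then sg J else 0 := by
  have h : (if n = c * (J * (J - 1)) then sg J else 0) =
      ∑ᶠ j : ℤ, if j = J then (if n = c * (J * (J - 1)) then sg J else 0) else 0 := by
    rw [finsum_eq_single _ J]
    · simp
    · intro x hx; rw [if_neg hx]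
  rw [h, si, si, ← finsum_add_distrib (si_fin hc _ _)]
  · apply finsum_congr
    intro j
    by_cases h1 : j = J
    · subst h1
      rw [if_pos rfl]
      simp
    · rw [if_neg h1, add_zero]
      apply if_congr _ rfl rfl
      omega
  · apply (Set.finite_singleton J).subset
    intro x hx
    by_contra hne
    apply hx
    simp only
    rw [if_neg (by simpa using hne)]

lemma rr_congr {a b : ℤ} (h : a % 8 = b % 8) (n : ℤ) : rr a n = rr b n := by
  unfold rr rankCount
  have : a % ((8 : ℕ) : ℤ) = b % ((8 : ℕ) : ℤ) := by exact_mod_cast h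
  rw [this]

lemma rr_neg (a n : ℤ) : rr (-a) n = rr a n := by
  unfold rr rankCount
  split_ifs with h
  · congr 1
    apply card_conj (fun x => x % ((8 : ℕ) : ℤ) = (-a) % ((8 : ℕ) : ℤ))
      (fun x => x % ((8 : ℕ) : ℤ) = a % ((8 : ℕ) : ℤ))
    intro x; push_cast; omega
  · rfl

lemma rr_sum {a n B : ℤ} (h : |a| + n ≤ B) :
    rr a n = ∑ i ∈ Finset.Icc (-B) B, (uu (a + 8 * i) n - uu (a + 8 * i + 1) n) := by
  by_cases hn : 1 ≤ n
  · have h1 : ∀ k, uu k n - uu (k + 1) n =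
        ∑ p : n.toNat.Partition, if partitionRank p = k then (1 : ℤ) else 0 := by
      intro k
      unfold uu
      rw [if_pos hn, if_pos hn, Finset.card_filter, Finset.card_filter]
      push_cast
      rw [← Finset.sum_sub_distrib]
      apply Finset.sum_congr rfl
      intro p _
      split_ifs <;> omega
    rw [Finset.sum_congr rfl (fun i _ => h1 _), Finset.sum_comm]
    unfold rr rankCount
    rw [if_pos hn, Finset.card_filter]
    push_cast
    apply Finset.sum_congr rfl
    intro p _
    have hb := rank_bounds (by omega) p
    have := abs_nonneg a
    have h3 := le_abs_self a
    have h4 := neg_abs_le a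
    by_cases hp : partitionRank p % 8 = a % 8
    · rw [if_pos hp, Finset.sum_eq_single ((partitionRank p - a) / 8)]
      · rw [if_pos (by omega)]
      · intro b _ hb'
        rw [if_neg (by omega)]
      · intro hh
        exfalso; apply hh
        rw [Finset.mem_Icc]; omega
    · rw [if_neg hp]
      symm
      apply Finset.sum_eq_zero
      intro i _
      rw [if_neg]; omega
  · rw [rr_nonpos _ (by omega)]
    symm; apply Finset.sum_eq_zero
    intro i _
    rw [uu_nonpos _ (by omega), uu_nonpos _ (by omega)]; rfl

lemma al_eq_sum {c : ℤ} (hc : 0 < c) (k n : ℤ) :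
    al c k n = ∑ j ∈ Finset.Icc (-|n|) (|n| + 1), sg j * uu (k - 2 * c * j) (n - c * (j * (j - 1))) := by
  unfold al
  apply finsum_eq_sum_of_support_subset
  intro j hj
  rw [Finset.coe_Icc]
  apply quad_bound hc
  by_contra hh
  apply hj
  beta_reduce
  rw [uu_nonpos _ (by omega), mul_zero]

/-- alternating sums of rank residue counts -/
noncomputable def ka (c a n : ℤ) : ℤ :=
  ∑ j ∈ Finset.Icc (-|n|) (|n| + 1), sg j * rr (a - 2 * c * j) (n - c * (j * (j - 1)))

lemma quad_nonneg (j : ℤ) : 0 ≤ j * (j - 1) := by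
  rcases le_or_gt j 0 with h | h
  · nlinarith
  · exact mul_nonneg (by omega) (by omega)

lemma ka_eq {c : ℤ} (hc : 0 < c) (a n B : ℤ) (hB : |a| + 2 * c * (|n| + 1) + |n| ≤ B) :
    ka c a n = ∑ i ∈ Finset.Icc (-B) B, (al c (a + 8 * i) n - al c (a + 8 * i + 1) n) := by
  unfold ka
  have e : ∀ i ∈ Finset.Icc (-B) B, al c (a + 8 * i) n - al c (a + 8 * i + 1) n =
      ∑ j ∈ Finset.Icc (-|n|) (|n| + 1), (sg j * uu (a + 8 * i - 2 * c * j) (n - c * (j * (j - 1)))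
        - sg j * uu (a + 8 * i + 1 - 2 * c * j) (n - c * (j * (j - 1)))) := by
    intro i _
    rw [al_eq_sum hc, al_eq_sum hc, ← Finset.sum_sub_distrib]
  rw [Finset.sum_congr rfl e, Finset.sum_comm]
  apply Finset.sum_congr rfl
  intro j hj
  rw [Finset.mem_Icc] at hj
  have h0 := quad_nonneg j
  have h1 := abs_nonneg n
  have h2 := le_abs_self n
  rw [rr_sum (B := B), Finset.mul_sum]
  · apply Finset.sum_congr rfl
    intro i _
    rw [← mul_sub]
    congr 3 <;> ring
  · have h3 : |a - 2 * c * j| ≤ |a| + 2 * c * (|n| + 1) := by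
      apply (abs_sub _ _).trans
      have : |2 * c * j| ≤ 2 * c * (|n| + 1) := by
        rw [abs_mul, abs_of_pos (by omega : 0 < 2 * c)]
        apply mul_le_mul_of_nonneg_left _ (by omega)
        rw [abs_le]; omega
      omega
    nlinarith

/-- folding a sum by the symmetry j -> 1 - j -/
lemma fold_sum (L : ℤ) (hL : 0 ≤ L) (f : ℤ → ℤ) :
    ∑ j ∈ Finset.Icc (-L) (L + 1), f j = ∑ j ∈ Finset.Icc 1 (L + 1), (f j + f (1 - j)) := by
  rw [Finset.sum_add_distrib]
  have : ∑ j ∈ Finset.Icc 1 (L + 1), f (1 - j) = ∑ j ∈ Finset.Icc (-L) 0, f j := by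
    apply Finset.sum_bij' (fun j _ => 1 - j) (fun j _ => 1 - j)
    · intro j hj; ring
    · intro j hj; ring
    · intro j hj; rfl
    · intro j hj; simp only [Finset.mem_Icc] at hj ⊢; omega
    · intro j hj; simp only [Finset.mem_Icc] at hj ⊢; omega
  rw [this, add_comm, ← Finset.sum_union]
  · congr 1
    ext x; simp only [Finset.mem_union, Finset.mem_Icc]; omega
  · rw [Finset.disjoint_left]
    intro x; simp only [Finset.mem_Icc]; omega

/-- d = 2 vanishing -/
lemma b2_zero (N : ℕ) : ∀ (K n t : ℤ), n ≤ N → 2 ≤ K → 2 * t = (K - 2) * (K - 1) →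
    2 ≤ (n + t) % 4 → al 1 K n + si 1 (K / 2 + 1) n = 0 := by
  induction N with
  | zero =>
    intro K n t hn hK _ _
    rw [al_nonpos one_pos _ (by exact_mod_cast hn), si_nonpos one_pos (by omega) (by exact_mod_cast hn)]
    rfl
  | succ N ih =>
    intro K n t hn hK ht hm
    have h := al_rec (c := 1) one_pos K n
    norm_num at h
    have e : (K + 1) / 2 = (K + 1 - 2) / 2 + 1 := by omega
    rw [h, si_succ one_pos]
    have e3 : K + 3 - 2 = K + 1 := by ring
    rw [e3, ← add_assoc, ih (K + 1) (n - K + 2 - 1) (t + K - 1) (by push_cast at hn; omega) (by omega)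
      (by linarith) (by rw [show n - K + 2 - 1 + (t + K - 1) = n + t by ring]; exact hm), zero_add]
    rw [if_neg]
    intro hf
    set f := (K + 1) / 2 with hfd
    have hcase : K = 2 * f - 1 ∨ K = 2 * f := by omega
    have key : (n + t) % 4 < 2 := by
      rcases hcase with h1 | h1
      · have h2 : n + t = (f - 1) * (3 * f - 1) := by
          rw [h1] at ht hf; nlinarith
        rw [h2]
        have : f % 4 = 0 ∨ f % 4 = 1 ∨ f % 4 = 2 ∨ f % 4 = 3 := by omega
        rcases this with h | h | h | h <;> simp [Int.mul_emod, Int.sub_emod, h]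
      · have h2 : n + t = f * (3 * f - 2) := by
          rw [h1] at ht hf; nlinarith
        rw [h2]
        have : f % 4 = 0 ∨ f % 4 = 1 ∨ f % 4 = 2 ∨ f % 4 = 3 := by omega
        rcases this with h | h | h | h <;> simp [Int.mul_emod, Int.sub_emod, h]
    omega

lemma al2_zero {K n t : ℤ} (hK : 2 ≤ K) (ht : 2 * t = (K - 2) * (K - 1))
    (hm : 2 ≤ (n + t) % 4) (hn : n % 2 = 1) : al 1 K n = 0 := by
  have := b2_zero n.toNat K n t (by omega) hK ht hm
  rwa [si_odd hn, add_zero] at this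

lemma ka_eq_sum_pos {c : ℤ} (a n : ℤ) : ka c a n =
    ∑ j ∈ Finset.Icc 1 (|n| + 1), sg j * (rr (a - 2 * c * j) (n - c * (j * (j - 1)))
      - rr (a - 2 * c * (1 - j)) (n - c * (j * (j - 1)))) := by
  unfold ka
  rw [fold_sum _ (abs_nonneg n)]
  apply Finset.sum_congr rfl
  intro j _
  rw [sg_one_sub, show (1 - j) * (1 - j - 1) = j * (j - 1) by ring]; ring

lemma al2_zero_all {K n t : ℤ} (ht : 2 * t = (K - 2) * (K - 1))
    (hm : 2 ≤ (n + t) % 4) (hn : n % 2 = 1) : al 1 K n = 0 := by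
  by_cases hK : 2 ≤ K
  · exact al2_zero hK ht hm hn
  · rw [al_symm one_pos]
    exact al2_zero (by omega) (by rw [ht]; ring) hm hn

lemma kaF1 {n : ℤ} (hn : n % 4 = 1) : ka 1 3 n + ka 1 4 n = 0 := by
  have h1 := abs_nonneg n
  rw [ka_eq one_pos 3 n (6 + 2 * (|n| + 1) + |n|) (by norm_num),
    ka_eq one_pos 4 n (6 + 2 * (|n| + 1) + |n|) (by norm_num), ← Finset.sum_add_distrib]
  apply Finset.sum_eq_zero
  intro i _
  have e1 : al 1 (3 + 8 * i) n = 0 := by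
    apply al2_zero_all (t := 4 * (8 * (i * i) + 3 * i) + 1) <;> first | omega | ring
  have e2 : al 1 (4 + 8 * i + 1) n = 0 := by
    apply al2_zero_all (t := 4 * (8 * (i * i) + 7 * i + 1) + 2) <;> first | omega | ring
  rw [e1, e2, show 3 + 8 * i + 1 = 4 + 8 * i by ring]; ring

lemma kaF2 {n : ℤ} (hn : n % 4 = 3) : ka 1 7 n + ka 1 8 n = 0 := by
  have h1 := abs_nonneg n
  rw [ka_eq one_pos 7 n (8 + 2 * (|n| + 1) + |n|) (by norm_num),
    ka_eq one_pos 8 n (8 + 2 * (|n| + 1) + |n|) (by norm_num), ← Finset.sum_add_distrib]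
  apply Finset.sum_eq_zero
  intro i _
  have e1 : al 1 (7 + 8 * i) n = 0 := by
    apply al2_zero_all (t := 4 * (8 * (i * i) + 11 * i + 3) + 3) <;> first | omega | ring
  have e2 : al 1 (8 + 8 * i + 1) n = 0 := by
    apply al2_zero_all (t := 4 * (8 * (i * i) + 15 * i + 7)) <;> first | omega | ring
  rw [e1, e2, show 7 + 8 * i + 1 = 8 + 8 * i by ring]; ring

lemma rr5 (n : ℤ) : rr 5 n = rr 3 n := by
  rw [← rr_neg]; apply rr_congr; norm_num
lemma rr6 (n : ℤ) : rr 6 n = rr 2 n := by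
  rw [← rr_neg]; apply rr_congr; norm_num
lemma rr7 (n : ℤ) : rr 7 n = rr 1 n := by
  rw [← rr_neg]; apply rr_congr; norm_num

/-- the two rank relations -/
lemma rank_F (N : ℕ) : ∀ n : ℤ, n ≤ N →
    (n % 4 = 1 → rr 1 n + rr 2 n - rr 3 n - rr 4 n = 0) ∧
    (n % 4 = 3 → rr 0 n + rr 1 n - rr 2 n - rr 3 n = 0) := by
  induction N with
  | zero =>
    intro n hn
    have hn : n ≤ 0 := by exact_mod_cast hn
    simp [rr_nonpos _ hn]
  | succ N ih =>
    intro n hn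
    have habs := abs_nonneg n
    have hmem : (1 : ℤ) ∈ Finset.Icc 1 (|n| + 1) := by rw [Finset.mem_Icc]; omega
    have hq : ∀ j : ℤ, 2 ≤ j → n - 1 * (j * (j - 1)) ≤ N := by
      intro j hj; push_cast at hn; nlinarith
    have hmod : ∀ j : ℤ, (j % 4 = 0 → j * (j - 1) % 4 = 0) ∧ (j % 4 = 1 → j * (j - 1) % 4 = 0)
        ∧ (j % 4 = 2 → j * (j - 1) % 4 = 2) ∧ (j % 4 = 3 → j * (j - 1) % 4 = 2) := by
      intro j
      refine ⟨?_, ?_, ?_, ?_⟩ <;> intro h <;> simp [Int.mul_emod, Int.sub_emod, h]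
    constructor
    · intro hm
      have h := kaF1 hm
      rw [ka_eq_sum_pos, ka_eq_sum_pos, ← Finset.sum_add_distrib, Finset.sum_eq_single_of_mem 1 hmem] at h
      · norm_num [sg] at h
        linarith
      · intro j hj hne
        rw [Finset.mem_Icc] at hj
        have hih := ih _ (hq j (by omega))
        obtain ⟨m0, m1, m2, m3⟩ := hmod j
        set x := n - 1 * (j * (j - 1)) with hx
        have hc : j % 4 = 0 ∨ j % 4 = 1 ∨ j % 4 = 2 ∨ j % 4 = 3 := by omega
        rw [← mul_add]
        rcases hc with hc | hc | hc | hc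
        · have := hih.1 (by have := m0 hc; omega)
          rw [rr_congr (b := 3) (by omega), rr_congr (a := 3 - 2 * 1 * (1 - j)) (b := 1) (by omega),
            rr_congr (a := 4 - 2 * 1 * j) (b := 4) (by omega), rr_congr (a := 4 - 2 * 1 * (1 - j)) (b := 2) (by omega)]
          rw [show rr 3 x - rr 1 x + (rr 4 x - rr 2 x) = 0 by linarith, mul_zero]
        · have := hih.1 (by have := m1 hc; omega)
          rw [rr_congr (b := 1) (by omega), rr_congr (a := 3 - 2 * 1 * (1 - j)) (b := 3) (by omega),
            rr_congr (a := 4 - 2 * 1 * j) (b := 2) (by omega), rr_congr (a := 4 - 2 * 1 * (1 - j)) (b := 4) (by omega)]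
          rw [show rr 1 x - rr 3 x + (rr 2 x - rr 4 x) = 0 by linarith, mul_zero]
        · have := hih.2 (by have := m2 hc; omega)
          rw [rr_congr (b := 7) (by omega), rr_congr (a := 3 - 2 * 1 * (1 - j)) (b := 5) (by omega),
            rr_congr (a := 4 - 2 * 1 * j) (b := 0) (by omega), rr_congr (a := 4 - 2 * 1 * (1 - j)) (b := 6) (by omega),
            rr7, rr5, rr6]
          rw [show rr 1 x - rr 3 x + (rr 0 x - rr 2 x) = 0 by linarith, mul_zero]
        · have := hih.2 (by have := m3 hc; omega)
          rw [rr_congr (b := 5) (by omega), rr_congr (a := 3 - 2 * 1 * (1 - j)) (b := 7) (by omega),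
            rr_congr (a := 4 - 2 * 1 * j) (b := 6) (by omega), rr_congr (a := 4 - 2 * 1 * (1 - j)) (b := 0) (by omega),
            rr7, rr5, rr6]
          rw [show rr 3 x - rr 1 x + (rr 2 x - rr 0 x) = 0 by linarith, mul_zero]
    · intro hm
      have h := kaF2 hm
      rw [ka_eq_sum_pos, ka_eq_sum_pos, ← Finset.sum_add_distrib, Finset.sum_eq_single_of_mem 1 hmem] at h
      · norm_num [sg] at h
        rw [rr5, rr6, rr7, rr_congr (a := 8) (b := 0) (by norm_num)] at h
        linarith
      · intro j hj hne
        rw [Finset.mem_Icc] at hj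
        have hih := ih _ (hq j (by omega))
        obtain ⟨m0, m1, m2, m3⟩ := hmod j
        set x := n - 1 * (j * (j - 1)) with hx
        have hc : j % 4 = 0 ∨ j % 4 = 1 ∨ j % 4 = 2 ∨ j % 4 = 3 := by omega
        rw [← mul_add]
        rcases hc with hc | hc | hc | hc
        · have := hih.2 (by have := m0 hc; omega)
          rw [rr_congr (b := 7) (by omega), rr_congr (a := 7 - 2 * 1 * (1 - j)) (b := 5) (by omega),
            rr_congr (a := 8 - 2 * 1 * j) (b := 0) (by omega), rr_congr (a := 8 - 2 * 1 * (1 - j)) (b := 6) (by omega),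
            rr7, rr5, rr6]
          rw [show rr 1 x - rr 3 x + (rr 0 x - rr 2 x) = 0 by linarith, mul_zero]
        · have := hih.2 (by have := m1 hc; omega)
          rw [rr_congr (b := 5) (by omega), rr_congr (a := 7 - 2 * 1 * (1 - j)) (b := 7) (by omega),
            rr_congr (a := 8 - 2 * 1 * j) (b := 6) (by omega), rr_congr (a := 8 - 2 * 1 * (1 - j)) (b := 0) (by omega),
            rr7, rr5, rr6]
          rw [show rr 3 x - rr 1 x + (rr 2 x - rr 0 x) = 0 by linarith, mul_zero]
        · have := hih.1 (by have := m2 hc; omega)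
          rw [rr_congr (b := 3) (by omega), rr_congr (a := 7 - 2 * 1 * (1 - j)) (b := 1) (by omega),
            rr_congr (a := 8 - 2 * 1 * j) (b := 4) (by omega), rr_congr (a := 8 - 2 * 1 * (1 - j)) (b := 2) (by omega)]
          rw [show rr 3 x - rr 1 x + (rr 4 x - rr 2 x) = 0 by linarith, mul_zero]
        · have := hih.1 (by have := m3 hc; omega)
          rw [rr_congr (b := 1) (by omega), rr_congr (a := 7 - 2 * 1 * (1 - j)) (b := 3) (by omega),
            rr_congr (a := 8 - 2 * 1 * j) (b := 2) (by omega), rr_congr (a := 8 - 2 * 1 * (1 - j)) (b := 4) (by omega)]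
          rw [show rr 1 x - rr 3 x + (rr 2 x - rr 4 x) = 0 by linarith, mul_zero]

/-- the base series for d = 4 -/
noncomputable def Aa (n : ℤ) : ℤ := al 2 3 n + si 2 1 n

lemma b4_eq (K : ℤ) (hK : 3 ≤ K) : ∀ (n t : ℤ), 2 * t = (K - 3) * (K - 2) → (n - t) % 2 = 0 →
    al 2 K n + si 2 (K / 4 + 1) n = Aa (n - t) := by
  induction K, hK using Int.leInduction with
  | base =>
    intro n t ht _
    have : t = 0 := by norm_num at ht; exact ht
    subst this
    simp [Aa]
  | succ K hK ih =>
    intro n t ht hm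
    have h := al_rec (c := 2) two_pos (K + 1) n
    norm_num at h
    rw [h, show K + 1 + 3 - 4 = K by ring, show n - (K + 1) + 4 - 1 = n - K + 2 by ring]
    have ih' := ih (n - K + 2) (t - K + 2) (by linarith) (by
      rw [show n - K + 2 - (t - K + 2) = n - t by ring]; exact hm)
    rw [show n - K + 2 - (t - K + 2) = n - t by ring] at ih'
    have hc : (K + 1 + 1) / 4 = K / 4 + 1 ∨ ((K + 1 + 1) / 4 = K / 4 ∧ (K % 4 = 0 ∨ K % 4 = 1)) := by omega
    rcases hc with hc | ⟨hc, hr⟩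
    · rw [hc]; exact ih'
    · rw [hc, si_succ two_pos, ← add_assoc, ih', if_neg, add_zero]
      intro hf
      set f := K / 4 with hfd
      rcases hr with hr | hr
      · have hk : K = 4 * f := by omega
        have h1 : t = 8 * (f * f) - 6 * f + 1 := by rw [hk] at ht; linarith
        omega
      · have hk : K = 4 * f + 1 := by omega
        have h1 : t = 8 * (f * f) - 2 * f := by rw [hk] at ht; linarith
        omega

lemma al4_eq {K n t : ℤ} (hK : 3 ≤ K) (ht : 2 * t = (K - 3) * (K - 2)) (h1 : t % 2 = 1)
    (hn : n % 2 = 1) : al 2 K n = Aa (n - t) := by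
  have := b4_eq K hK n t ht (by omega)
  rwa [si_odd hn, add_zero] at this

lemma Aa_neg {n : ℤ} (h : n < 0) : Aa n = 0 := by
  unfold Aa
  rw [al_nonpos two_pos _ h.le, zero_add]
  unfold si
  apply finsum_eq_zero_of_forall_eq_zero
  intro j
  rw [if_neg]
  rintro ⟨_, h1⟩
  have := quad_nonneg j
  omega

lemma sum_Icc_int (N : ℕ) (f : ℤ → ℤ) :
    ∑ j ∈ Finset.Icc (1 : ℤ) N, f j = ∑ j ∈ Finset.range N, f (j + 1) := by
  induction N with
  | zero => simp
  | succ N ih =>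
    rw [Finset.sum_range_succ, ← ih]
    have : Finset.Icc (1 : ℤ) ((N + 1 : ℕ) : ℤ) = insert ((N : ℤ) + 1) (Finset.Icc (1 : ℤ) N) := by
      ext x; simp only [Finset.mem_insert, Finset.mem_Icc]; push_cast; omega
    rw [this, Finset.sum_insert (by simp), add_comm]

lemma al4_large {k n : ℤ} (h : 5 * |n| + 4 ≤ k) : al 2 k n = 0 := by
  apply al_large two_pos; omega

/-- sums over symmetric windows, first kind -/
lemma window1 (n : ℤ) (B : ℕ) :
    ∑ i ∈ Finset.Icc (-(B : ℤ)) B, (al 2 (8 * i) n - al 2 (8 * i + 1) n - al 2 (8 * i + 4) n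
      + al 2 (8 * i + 5) n) =
    2 * ∑ i ∈ Finset.range B, (-al 2 (8 * i + 4) n + al 2 (8 * i + 5) n + al 2 (8 * i + 8) n
      - al 2 (8 * i + 9) n) + 2 * (al 2 (8 * B + 5) n - al 2 (8 * B + 4) n) := by
  induction B with
  | zero =>
    have h0 := al_symm two_pos 0 n
    have h1 := al_symm two_pos 1 n
    norm_num at h0 h1
    simp
    rw [h0, h1]; ring
  | succ B ih =>
    have e : Finset.Icc (-((B + 1 : ℕ) : ℤ)) ((B + 1 : ℕ) : ℤ) =
      insert ((B : ℤ) + 1) (insert (-(B : ℤ) - 1) (Finset.Icc (-(B : ℤ)) B)) := by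
      ext x; simp only [Finset.mem_insert, Finset.mem_Icc]; push_cast; omega
    rw [e, Finset.sum_insert, Finset.sum_insert, ih, Finset.sum_range_succ]
    · rw [al_symm two_pos (8 * (-(B : ℤ) - 1)), al_symm two_pos (8 * (-(B : ℤ) - 1) + 1),
        al_symm two_pos (8 * (-(B : ℤ) - 1) + 4), al_symm two_pos (8 * (-(B : ℤ) - 1) + 5)]
      push_cast
      ring_nf
    · simp
    · simp only [Finset.mem_insert, Finset.mem_Icc]; omega

lemma shift_window (f : ℤ → ℤ) (P b B : ℤ) (h1 : ∀ i, i ≤ -b → f i = P)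
    (h0 : ∀ i, b ≤ i → f i = 0) (j : ℤ) (hj : |j| + |b| ≤ B) :
    ∑ i ∈ Finset.Icc (-B) (B + 1), f (i - j) = ∑ i ∈ Finset.Icc (-B) (B + 1), f i + j * P := by
  have hB0 : 0 ≤ B := by
    have := abs_nonneg j
    have := abs_nonneg b
    omega
  have step : ∀ j : ℤ, ∑ i ∈ Finset.Icc (-B) (B + 1), f (i - (j + 1)) + f (B + 1 - j) =
      ∑ i ∈ Finset.Icc (-B) (B + 1), f (i - j) + f (-B - (j + 1)) := by
    intro j
    by_cases hB : -B ≤ B + 1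
    · have e1 : ∑ i ∈ Finset.Icc (-B) (B + 1), f (i - (j + 1)) =
          ∑ i ∈ Finset.Icc (-B - 1) B, f (i - j) := by
        apply Finset.sum_bij' (fun i _ => i - 1) (fun i _ => i + 1)
        · intro i _; ring
        · intro i _; ring
        · intro i _; congr 1; ring
        · intro i hi; simp only [Finset.mem_Icc] at hi ⊢; omega
        · intro i hi; simp only [Finset.mem_Icc] at hi ⊢; omega
      have e2 : insert (B + 1) (Finset.Icc (-B - 1) B) = insert (-B - 1) (Finset.Icc (-B) (B + 1)) := by
        ext x; simp only [Finset.mem_insert, Finset.mem_Icc]; omega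
      have e3 := congrArg (fun s => ∑ i ∈ s, f (i - j)) e2
      rw [Finset.sum_insert (by simp), Finset.sum_insert (by simp)] at e3
      rw [e1, show -B - (j + 1) = -B - 1 - j by ring]; linarith
    · omega
  have pos : ∀ k : ℕ, (k : ℤ) + |b| ≤ B → ∑ i ∈ Finset.Icc (-B) (B + 1), f (i - k) =
      ∑ i ∈ Finset.Icc (-B) (B + 1), f i + k * P := by
    intro k
    induction k with
    | zero => intro _; simp
    | succ k ih =>
      intro hk
      push_cast at hk ⊢
      have h3 := ih (by omega)
      have h4 := step k
      have := le_abs_self b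
      rw [h0 _ (by omega), h1 (-B - (k + 1)) (by omega)] at h4
      linarith
  have neg : ∀ k : ℕ, (k : ℤ) + |b| ≤ B → ∑ i ∈ Finset.Icc (-B) (B + 1), f (i - (-(k : ℤ))) =
      ∑ i ∈ Finset.Icc (-B) (B + 1), f i - k * P := by
    intro k
    induction k with
    | zero => intro _; simp
    | succ k ih =>
      intro hk
      push_cast at hk ⊢
      have h3 := ih (by omega)
      have h4 := step (-((k : ℤ) + 1))
      have := le_abs_self b
      rw [h0 _ (by omega), h1 _ (by omega), show -((k : ℤ) + 1) + 1 = -k by ring] at h4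
      linarith
  rcases le_total 0 j with h | h
  · obtain ⟨k, rfl⟩ := Int.eq_ofNat_of_zero_le h
    exact pos k (by simpa using hj)
  · obtain ⟨k, hk⟩ := Int.eq_ofNat_of_zero_le (show 0 ≤ -j by omega)
    have : j = -(k : ℤ) := by omega
    subst this
    rw [neg k (by simpa using hj)]; ring

lemma window2 (n e B : ℤ) (he : 0 ≤ e) (hB : 2 * |n| + e + 1 ≤ B) :
    ∑ i ∈ Finset.Icc (-B) (B + 1), al 2 (4 * i + e) n =
      ∑ j ∈ Finset.Icc 1 (|n| + 1), sg j * (2 * j - 1) * pq (n - 2 * (j * (j - 1))) := by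
  rw [Finset.sum_congr rfl (fun i _ => al_eq_sum two_pos (4 * i + e) n), Finset.sum_comm]
  have h2 := abs_nonneg n
  have h3 := le_abs_self n
  have key : ∀ j ∈ Finset.Icc (-|n|) (|n| + 1), ∑ i ∈ Finset.Icc (-B) (B + 1),
      sg j * uu (4 * i + e - 2 * 2 * j) (n - 2 * (j * (j - 1))) =
      sg j * ∑ i ∈ Finset.Icc (-B) (B + 1), uu (4 * i + e) (n - 2 * (j * (j - 1))) +
      sg j * j * pq (n - 2 * (j * (j - 1))) := by
    intro j hj
    rw [Finset.mem_Icc] at hj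
    have h4 := quad_nonneg j
    have := shift_window (fun i => uu (4 * i + e) (n - 2 * (j * (j - 1)))) (pq (n - 2 * (j * (j - 1))))
      (|n| + e) B ?_ ?_ j ?_
    · rw [← Finset.mul_sum, mul_assoc (sg j) j, ← mul_add, ← this]
      congr 1
      apply Finset.sum_congr rfl
      intro i _
      congr 1; ring
    · intro i hi; apply uu_small; omega
    · intro i hi; apply uu_large; omega
    · rw [abs_of_nonneg (show 0 ≤ |n| + e by omega)]
      have : |j| ≤ |n| + 1 := by rw [abs_le]; omega
      omega
  rw [Finset.sum_congr rfl key, Finset.sum_add_distrib, fold_sum _ h2, fold_sum _ h2]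
  rw [Finset.sum_eq_zero, zero_add]
  · apply Finset.sum_congr rfl
    intro j _
    rw [sg_one_sub, show (1 - j) * (1 - j - 1) = j * (j - 1) by ring]; ring
  · intro j _
    rw [sg_one_sub, show (1 - j) * (1 - j - 1) = j * (j - 1) by ring]; ring

/-- signs attached to odd triangular numbers -/
def eps (m : ℕ) : ℤ := if m % 8 = 1 ∨ m % 8 = 6 then 1 else if m % 8 = 2 ∨ m % 8 = 5 then -1 else 0
/-- indicator of odd triangular numbers -/
def odi (m : ℕ) : ℤ := if m % 4 = 1 ∨ m % 4 = 2 then 1 else 0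

lemma tri_cast (m : ℕ) : 2 * ((m * (m + 1) / 2 : ℕ) : ℤ) = (m : ℤ) * (m + 1) := by
  have h := Nat.div_mul_cancel (Nat.even_mul_succ_self m).two_dvd
  have : ((m * (m + 1) / 2 : ℕ) : ℤ) * 2 = (m : ℤ) * (m + 1) := by exact_mod_cast h
  linarith

lemma tri_parity (m : ℕ) : m * (m + 1) / 2 % 2 = if m % 4 = 1 ∨ m % 4 = 2 then 1 else 0 := by
  obtain ⟨q, r, hr, rfl⟩ : ∃ q r, r < 4 ∧ m = 4 * q + r := ⟨m / 4, m % 4, by omega, by omega⟩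
  interval_cases r
  · rw [show (4 * q + 0) * (4 * q + 0 + 1) = 2 * (2 * (4 * q * q + q)) by ring, Nat.mul_div_cancel_left _ two_pos]
    split_ifs <;> omega
  · rw [show (4 * q + 1) * (4 * q + 1 + 1) = 2 * (2 * (4 * q * q + 3 * q) + 1) by ring, Nat.mul_div_cancel_left _ two_pos]
    split_ifs <;> omega
  · rw [show (4 * q + 2) * (4 * q + 2 + 1) = 2 * (2 * (4 * q * q + 5 * q + 1) + 1) by ring, Nat.mul_div_cancel_left _ two_pos]
    split_ifs <;> omega
  · rw [show (4 * q + 3) * (4 * q + 3 + 1) = 2 * (2 * (4 * q * q + 7 * q + 3)) by ring, Nat.mul_div_cancel_left _ two_pos]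
    split_ifs <;> omega

lemma al_tri {n : ℤ} (hn : n % 2 = 1) (m : ℕ) (hm : m % 4 = 1 ∨ m % 4 = 2) :
    al 2 (m + 3) n = Aa (n - (m * (m + 1) / 2 : ℕ)) := by
  apply al4_eq (by omega) _ _ hn
  · rw [tri_cast]; ring
  · have := tri_parity m
    rw [if_pos hm] at this; omega

lemma block_sum (k : ℕ) (f : ℕ → ℤ) (B : ℕ) : ∑ m ∈ Finset.range (k * B), f m =
    ∑ i ∈ Finset.range B, ∑ r ∈ Finset.range k, f (k * i + r) := by
  induction B with
  | zero => simp
  | succ B ih => rw [Finset.sum_range_succ, ← ih, Nat.mul_succ, Finset.sum_range_add]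

lemma trunc_tri (n : ℕ) (f : ℕ → ℤ) (M : ℕ) (hM : n + 1 ≤ M) :
    ∑ m ∈ Finset.range M, f m * Aa (n - (m * (m + 1) / 2 : ℕ)) =
    ∑ m ∈ Finset.range (n + 1), f m * Aa (n - (m * (m + 1) / 2 : ℕ)) := by
  symm
  apply Finset.sum_subset
  · intro x; simp only [Finset.mem_range]; omega
  · intro m _ hm
    simp only [Finset.mem_range, not_lt] at hm
    rw [Aa_neg, mul_zero]
    have := tri_cast m
    nlinarith

lemma rank_R1 (n : ℕ) (hn : n % 2 = 1) :
    ∑ j ∈ Finset.range (n + 1), (rr 0 (n - 2 * (j * (j + 1))) - rr 4 (n - 2 * (j * (j + 1)))) =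
    - ∑ m ∈ Finset.range (n + 1), eps m * Aa (n - (m * (m + 1) / 2 : ℕ)) := by
  have hz : (n : ℤ) % 2 = 1 := by omega
  have hab : |(n : ℤ)| = n := abs_of_nonneg (by omega)
  set B : ℕ := 100 * n + 100 with hB
  have h0 := ka_eq two_pos 0 n B (by rw [hab]; push_cast; norm_num; omega)
  have h4 := ka_eq two_pos 4 n B (by rw [hab]; push_cast; norm_num; omega)
  have hw := window1 n B
  rw [al4_large (k := 8 * B + 5) (by rw [hab]; push_cast; omega),
    al4_large (k := 8 * B + 4) (by rw [hab]; push_cast; omega)] at hw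
  have hs : ka 2 0 n - ka 2 4 n = 2 * ∑ j ∈ Finset.range (n + 1),
      (rr 0 (n - 2 * (j * (j + 1))) - rr 4 (n - 2 * (j * (j + 1)))) := by
    rw [ka_eq_sum_pos, ka_eq_sum_pos, ← Finset.sum_sub_distrib, hab,
      show (n : ℤ) + 1 = ((n + 1 : ℕ) : ℤ) by push_cast; rfl, sum_Icc_int, Finset.mul_sum]
    apply Finset.sum_congr rfl
    intro j _
    rw [show ((j : ℤ) + 1) * ((j : ℤ) + 1 - 1) = j * (j + 1) by ring]
    by_cases hj : j % 2 = 0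
    · rw [rr_congr (a := 0 - 2 * 2 * ((j : ℤ) + 1)) (b := 4) (by omega),
        rr_congr (a := 0 - 2 * 2 * (1 - ((j : ℤ) + 1))) (b := 0) (by omega),
        rr_congr (a := 4 - 2 * 2 * ((j : ℤ) + 1)) (b := 0) (by omega),
        rr_congr (a := 4 - 2 * 2 * (1 - ((j : ℤ) + 1))) (b := 4) (by omega), sg, if_neg (by omega)]
      ring
    · rw [rr_congr (a := 0 - 2 * 2 * ((j : ℤ) + 1)) (b := 0) (by omega),
        rr_congr (a := 0 - 2 * 2 * (1 - ((j : ℤ) + 1))) (b := 4) (by omega),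
        rr_congr (a := 4 - 2 * 2 * ((j : ℤ) + 1)) (b := 4) (by omega),
        rr_congr (a := 4 - 2 * 2 * (1 - ((j : ℤ) + 1))) (b := 0) (by omega), sg, if_pos (by omega)]
      ring
  have hs2 : ka 2 0 n - ka 2 4 n = ∑ i ∈ Finset.Icc (-(B : ℤ)) B, (al 2 (8 * i) n - al 2 (8 * i + 1) n - al 2 (8 * i + 4) n
      + al 2 (8 * i + 5) n) := by
    rw [h0, h4, ← Finset.sum_sub_distrib]
    apply Finset.sum_congr rfl
    intro i _
    ring_nf
  have hb := block_sum 8 (fun m => eps m * Aa (n - (m * (m + 1) / 2 : ℕ))) B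
  rw [trunc_tri n eps _ (by omega)] at hb
  have hb2 : ∑ i ∈ Finset.range B, (-al 2 (8 * i + 4) n + al 2 (8 * i + 5) n + al 2 (8 * i + 8) n
      - al 2 (8 * i + 9) n) = - ∑ m ∈ Finset.range (n + 1), eps m * Aa (n - (m * (m + 1) / 2 : ℕ)) := by
    rw [hb, ← Finset.sum_neg_distrib]
    apply Finset.sum_congr rfl
    intro i _
    have a1 := al_tri hz (8 * i + 1) (by omega)
    have a2 := al_tri hz (8 * i + 2) (by omega)
    have a5 := al_tri hz (8 * i + 5) (by omega)
    have a6 := al_tri hz (8 * i + 6) (by omega)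
    simp only [Finset.sum_range_succ, Finset.sum_range_zero, add_zero, zero_add]
    rw [← a1, ← a2, ← a5, ← a6]
    have v : ∀ r, r < 8 → eps (8 * i + r) = if r = 1 ∨ r = 6 then 1 else if r = 2 ∨ r = 5 then -1 else 0 := by
      intro r hr
      unfold eps
      rw [show (8 * i + r) % 8 = r by omega]
    have v0 := v 0 (by norm_num)
    rw [add_zero] at v0
    rw [v0, v 1 (by norm_num), v 2 (by norm_num), v 3 (by norm_num), v 4 (by norm_num), v 5 (by norm_num),
      v 6 (by norm_num), v 7 (by norm_num)]
    push_cast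
    norm_num
    ring_nf
  rw [hb2] at hw
  linarith

lemma rank_R2 (n : ℕ) (hn : n % 2 = 1) :
    ∑ m ∈ Finset.range (n + 1), odi m * Aa (n - (m * (m + 1) / 2 : ℕ)) =
    - ∑ j ∈ Finset.range (n + 1), (-1) ^ j * (2 * (j : ℤ) + 1) * pp (n - 2 * (j * (j + 1))) := by
  have hz : (n : ℤ) % 2 = 1 := by omega
  have hab : |(n : ℤ)| = n := abs_of_nonneg (by omega)
  set B : ℕ := 100 * n + 100 with hB
  have h0 := window2 n 0 B (by norm_num) (by rw [hab]; push_cast; omega)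
  have h1 := window2 n 1 B (by norm_num) (by rw [hab]; push_cast; omega)
  rw [fold_sum _ (by omega)] at h0 h1
  have hs : ∑ i ∈ Finset.Icc (1 : ℤ) (B + 1), (al 2 (4 * i) n + al 2 (4 * i + 1) n) =
      ∑ j ∈ Finset.Icc 1 (|(n : ℤ)| + 1), sg j * (2 * j - 1) * pq (n - 2 * (j * (j - 1))) := by
    have h2 := congrArg₂ (· + ·) h0 h1
    rw [← Finset.sum_add_distrib] at h2
    have h3 : ∀ i ∈ Finset.Icc (1 : ℤ) (B + 1), (al 2 (4 * i + 0) n + al 2 (4 * (1 - i) + 0) n +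
        (al 2 (4 * i + 1) n + al 2 (4 * (1 - i) + 1) n)) = 2 * (al 2 (4 * i) n + al 2 (4 * i + 1) n) := by
      intro i _
      rw [al_symm two_pos (4 * (1 - i) + 0), al_symm two_pos (4 * (1 - i) + 1)]
      ring_nf
    rw [Finset.sum_congr rfl h3, ← Finset.mul_sum] at h2
    linarith
  rw [hab, show (n : ℤ) + 1 = ((n + 1 : ℕ) : ℤ) by push_cast; rfl,
    show (B : ℤ) + 1 = ((B + 1 : ℕ) : ℤ) by push_cast; rfl, sum_Icc_int, sum_Icc_int] at hs
  have hb := block_sum 4 (fun m => odi m * Aa (n - (m * (m + 1) / 2 : ℕ))) (B + 1)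
  rw [trunc_tri n odi _ (by omega)] at hb
  rw [hb, ← Finset.sum_neg_distrib]
  calc _ = ∑ j ∈ Finset.range (B + 1), (al 2 (4 * ((j : ℤ) + 1)) n + al 2 (4 * ((j : ℤ) + 1) + 1) n) := by
        apply Finset.sum_congr rfl
        intro i _
        have a1 := al_tri hz (4 * i + 1) (by omega)
        have a2 := al_tri hz (4 * i + 2) (by omega)
        simp only [Finset.sum_range_succ, Finset.sum_range_zero, add_zero, zero_add]
        rw [← a1, ← a2]
        have v : ∀ r, r < 4 → odi (4 * i + r) = if r = 1 ∨ r = 2 then 1 else 0 := by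
          intro r hr
          unfold odi
          rw [show (4 * i + r) % 4 = r by omega]
        have v0 := v 0 (by norm_num)
        rw [add_zero] at v0
        rw [v0, v 1 (by norm_num), v 2 (by norm_num), v 3 (by norm_num)]
        push_cast
        norm_num
        ring_nf
    _ = _ := hs
    _ = _ := by
        apply Finset.sum_congr rfl
        intro j _
        have e : sg ((j : ℤ) + 1) = - (-1) ^ j := by
          rw [sg_add_one, sg]
          congr 1
          split_ifs with h
          · rw [Even.neg_one_pow]; rw [Nat.even_iff]; omega
          · rw [Odd.neg_one_pow]; rw [Nat.odd_iff]; omega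
        have e2 : pq ((n : ℤ) - 2 * (j * (j + 1))) = pp ((n : ℤ) - 2 * (j * (j + 1))) := by
          unfold pq
          split_ifs with h
          · rfl
          · rw [pp, if_neg (by omega)]
        rw [e, show ((j : ℤ) + 1) * ((j : ℤ) + 1 - 1) = j * (j + 1) by ring, e2]; ring
section SeriesPart
open PowerSeries Filter Topology
open scoped PowerSeries.WithPiTopology

lemma lim_zero_of_dvd {f : ℕ → ℂ⟦X⟧} (h : ∀ N, (X : ℂ⟦X⟧) ^ N ∣ f N) :
    Tendsto f atTop (𝓝 0) := by
  rw [WithPiTopology.tendsto_iff_coeff_tendsto]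
  intro d
  refine tendsto_atTop_of_eventually_const (i₀ := d + 1) (fun N hN => ?_)
  rw [map_zero]
  exact X_pow_dvd_iff.1 (h N) d (by omega)

lemma lim_of_dvd {f : ℕ → ℂ⟦X⟧} {F : ℂ⟦X⟧} (h : ∀ N, (X : ℂ⟦X⟧) ^ N ∣ f N - F) :
    Tendsto f atTop (𝓝 F) := by
  have := (lim_zero_of_dvd h).add_const F
  simpa using this

lemma lim_expand (k : ℕ) (hk : k ≠ 0) {f : ℕ → ℂ⟦X⟧} {F : ℂ⟦X⟧} (h : Tendsto f atTop (𝓝 F)) :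
    Tendsto (fun n => expand k hk (f n)) atTop (𝓝 (expand k hk F)) := by
  rw [WithPiTopology.tendsto_iff_coeff_tendsto] at h ⊢
  intro d
  simp only [coeff_expand]
  split_ifs
  · exact h _
  · exact tendsto_const_nhds

/-- Finite weighted product. -/
noncomputable def prW (w : ℕ → ℂ) (N : ℕ) : ℂ⟦X⟧ :=
  ∏ k ∈ Finset.range N, (1 - C (w (k + 1)) * X ^ (k + 1))

lemma prW_succ (w : ℕ → ℂ) (N : ℕ) :
    prW w (N + 1) = prW w N * (1 - C (w (N + 1)) * X ^ (N + 1)) := by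
  rw [prW, Finset.prod_range_succ, ← prW]

lemma prW_zero (w : ℕ → ℂ) : prW w 0 = 1 := by simp [prW]

/-- Infinite weighted product. -/
noncomputable def phW (w : ℕ → ℂ) : ℂ⟦X⟧ := mk fun n => coeff n (prW w n)

lemma coeff_prW_stable (w : ℕ → ℂ) (n j : ℕ) :
    coeff n (prW w (n + j)) = coeff n (prW w n) := by
  induction j with
  | zero => rfl
  | succ j ih =>
    rw [← add_assoc, prW_succ, mul_sub, mul_one, map_sub, ih, sub_eq_self]
    have : (X : ℂ⟦X⟧) ^ (n + j + 1) ∣ prW w (n + j) * (C (w (n + j + 1)) * X ^ (n + j + 1)) :=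
      Dvd.intro_left (prW w (n + j) * C (w (n + j + 1))) (by ring)
    exact X_pow_dvd_iff.1 this n (by omega)

lemma phW_dvd (w : ℕ → ℂ) (N : ℕ) : (X : ℂ⟦X⟧) ^ (N + 1) ∣ prW w N - phW w := by
  rw [X_pow_dvd_iff]
  intro m hm
  obtain ⟨j, rfl⟩ := Nat.exists_eq_add_of_le (Nat.le_of_lt_succ hm)
  rw [map_sub, phW, coeff_mk, coeff_prW_stable, sub_self]

lemma lim_prW (w : ℕ → ℂ) : Tendsto (prW w) atTop (𝓝 (phW w)) :=
  lim_of_dvd fun N => (pow_dvd_pow _ (Nat.le_succ N)).trans (phW_dvd w N)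

/-- Generating function with multiplicative weights. -/
noncomputable def gfW (w : ℕ → ℂ) : ℂ⟦X⟧ :=
  mk fun n => ∑ p : n.Partition, (p.parts.map w).prod

lemma gfW_mul (w : ℕ → ℂ) : gfW w * phW w = 1 := by
  have h0 : gfW w = Nat.Partition.genFun (fun i j => w i ^ j) := by
    ext n
    rw [gfW, coeff_mk, Nat.Partition.coeff_genFun]
    apply Finset.sum_congr rfl
    intro p _
    rw [Finset.prod_multiset_map_count, Finsupp.prod]
    simp
  have h1 := (Nat.Partition.hasProd_genFun (fun i j => w i ^ j)).tendsto_prod_nat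
  rw [← h0] at h1
  have h2 := h1.mul (lim_prW w)
  refine tendsto_nhds_unique h2 ?_
  have : ∀ N, (∏ i ∈ Finset.range N, ((1 : ℂ⟦X⟧) + ∑' j, w (i + 1) ^ (j + 1) • X ^ ((i + 1) * (j + 1)))) *
      prW w N = 1 := by
    intro N
    rw [prW, ← Finset.prod_mul_distrib]
    apply Finset.prod_eq_one
    intro i _
    have hc : (C (w (i+1)) * X ^ (i + 1) : ℂ⟦X⟧).constantCoeff = 0 := by simp
    have hs := WithPiTopology.summable_pow_of_constantCoeff_eq_zero hc
    have e := WithPiTopology.tsum_pow_mul_one_sub_of_constantCoeff_eq_zero hc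
    rw [hs.tsum_eq_zero_add, pow_zero] at e
    convert e using 2
    refine congrArg _ ?_
    refine tsum_congr fun j => ?_
    rw [smul_eq_C_mul, mul_pow, ← pow_mul, map_pow]
  simp only [this]
  exact tendsto_const_nhds

lemma phW_ne (w : ℕ → ℂ) : phW w ≠ 0 := right_ne_zero_of_mul_eq_one (gfW_mul w)

/-- `∏ (1 - c q^k)`. -/
noncomputable def Ph (c : ℂ) : ℂ⟦X⟧ := phW fun _ => c
/-- finite version -/
noncomputable def pr (c : ℂ) : ℕ → ℂ⟦X⟧ := prW (fun _ => c)

lemma pr_succ (c : ℂ) (N : ℕ) : pr c (N + 1) = pr c N * (1 - C c * X ^ (N + 1)) := prW_succ _ _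
lemma pr_zero (c : ℂ) : pr c 0 = 1 := prW_zero _
lemma lim_pr (c : ℂ) : Tendsto (pr c) atTop (𝓝 (Ph c)) := by
  unfold pr Ph; exact lim_prW _
lemma Ph_ne (c : ℂ) : Ph c ≠ 0 := phW_ne _

lemma coeff0_Ph (c : ℂ) : coeff 0 (Ph c) = 1 := by
  rw [Ph, phW, coeff_mk, prW_zero]; simp

lemma Ph_mul_neg (a : ℂ) : Ph a * Ph (-a) = expand 2 two_ne_zero (Ph (a ^ 2)) := by
  refine tendsto_nhds_unique ((lim_pr a).mul (lim_pr (-a))) ?_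
  have : (fun N => pr a N * pr (-a) N) = fun N => expand 2 two_ne_zero (pr (a ^ 2) N) := by
    funext N
    induction N with
    | zero => simp [pr_zero]
    | succ N ih =>
      rw [pr_succ, pr_succ, pr_succ, map_mul, ← ih]
      simp only [map_sub, map_one, map_mul, expand_C, map_pow, expand_X, map_neg]
      ring
  rw [this]
  exact lim_expand 2 two_ne_zero (lim_pr _)

end SeriesPart
section JTPpart
open PowerSeries Filter Topology
open scoped PowerSeries.WithPiTopology

/-- Series supported on triangular numbers. -/
noncomputable def tri (f : ℕ → ℂ) : ℂ⟦X⟧ :=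
  mk fun n => ∑ m ∈ Finset.range (n + 1), if m * (m + 1) / 2 = n then f m else 0

lemma le_tri (m : ℕ) : m ≤ m * (m + 1) / 2 := by
  rw [Nat.le_div_iff_mul_le two_pos]
  rcases Nat.eq_zero_or_pos m with h | h
  · subst h; simp
  · exact Nat.mul_le_mul_left m (by omega)

lemma tri_dvd (f : ℕ → ℂ) (N : ℕ) :
    (X : ℂ⟦X⟧) ^ (N + 1) ∣ (∑ m ∈ Finset.range (N + 1), C (f m) * X ^ (m * (m + 1) / 2)) - tri f := by
  rw [X_pow_dvd_iff]
  intro k hk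
  rw [map_sub, tri, coeff_mk, map_sum, sub_eq_zero]
  symm
  have : ∀ m, coeff k (C (f m) * X ^ (m * (m + 1) / 2)) = if m * (m + 1) / 2 = k then f m else 0 := by
    intro m
    rw [coeff_C_mul, coeff_X_pow]
    simp [eq_comm]
  simp only [this]
  apply Finset.sum_subset
  · intro x; simp; omega
  · intro m _ hm
    rw [if_neg]
    have := le_tri m
    simp at hm
    omega

lemma coeff_tri_mul (f : ℕ → ℂ) (G : ℂ⟦X⟧) (n : ℕ) :
    coeff n (tri f * G) = ∑ m ∈ Finset.range (n + 1),
      f m * (if m * (m + 1) / 2 ≤ n then coeff (n - m * (m + 1) / 2) G else 0) := by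
  have h := (tri_dvd f n).mul_right G
  rw [sub_mul] at h
  have h2 := X_pow_dvd_iff.1 h n (Nat.lt_succ_self n)
  rw [map_sub, sub_eq_zero] at h2
  rw [← h2, Finset.sum_mul, map_sum]
  apply Finset.sum_congr rfl
  intro m _
  rw [mul_assoc, coeff_C_mul, coeff_X_pow_mul']

/-- inverse of the finite product -/
noncomputable def ui (k : ℕ) : ℂ⟦X⟧ := (pr 1 k)⁻¹

lemma pr_const (c : ℂ) (k : ℕ) : constantCoeff (pr c k) = 1 := by
  induction k with
  | zero => simp [pr_zero]
  | succ k ih => rw [pr_succ, map_mul, ih]; simp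

lemma pr_ui (k : ℕ) : pr 1 k * ui k = 1 := by
  rw [ui, PowerSeries.mul_inv_cancel]
  rw [pr_const]; exact one_ne_zero

lemma ui_succ (k : ℕ) : ui k = (1 - X ^ (k + 1)) * ui (k + 1) := by
  have h1 := pr_ui k
  have h2 := pr_ui (k + 1)
  rw [pr_succ, map_one, one_mul] at h2
  calc ui k = ui k * (pr 1 k * (1 - X ^ (k + 1)) * ui (k + 1)) := by rw [h2, mul_one]
    _ = (pr 1 k * ui k) * ((1 - X ^ (k + 1)) * ui (k + 1)) := by ring
    _ = _ := by rw [h1, one_mul]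

/-- Coefficients of the finite triple product. -/
noncomputable def cj (N n : ℕ) : ℂ⟦X⟧ :=
  if n ≤ N then pr 1 (2 * N + 1) * ui (N - n) * ui (N + n + 1) else 0

lemma cj_rec_succ (N n : ℕ) (h : n + 1 ≤ N + 1) :
    cj (N + 1) (n + 1) = (1 + X ^ (2 * N + 2)) * cj N (n + 1) + X ^ (N - n) * cj N n
      + X ^ (N + n + 3) * cj N (n + 2) := by
  have hp : pr 1 (2 * (N + 1) + 1) = pr 1 (2 * N + 1) * (1 - X ^ (2 * N + 2)) * (1 - X ^ (2 * N + 3)) := by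
    rw [show 2 * (N + 1) + 1 = 2 * N + 1 + 1 + 1 by ring, pr_succ, pr_succ]; simp
  obtain ⟨d, rfl⟩ := Nat.exists_eq_add_of_le (Nat.le_of_succ_le_succ h)
  unfold cj
  rw [if_pos h, if_pos (show n ≤ n + d by omega), hp]
  rcases d with _ | _ | d
  · rw [if_neg (by omega), if_neg (by omega), show n + 0 + 1 - (n + 1) = 0 by omega, show n + 0 - n = 0 by omega,
      ui_succ (n + 0 + n + 1), ui_succ (n + 0 + n + 1 + 1),
      show n + 0 + 1 + (n + 1) + 1 = n + 0 + n + 1 + 1 + 1 by ring]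
    ring
  · rw [if_pos (by omega), if_neg (by omega), show n + (0 + 1) + 1 - (n + 1) = 1 by omega, show n + (0 + 1) - n = 1 by omega,
      show n + (0 + 1) - (n + 1) = 0 by omega, ui_succ 0,
      ui_succ (n + (0 + 1) + n + 1),  ui_succ (n + (0 + 1) + (n + 1) + 1), 
      show n + (0 + 1) + 1 + (n + 1) + 1 = n + (0 + 1) + n + 1 + 1 + 1 by ring,
      show n + (0 + 1) + (n + 1) + 1 + 1 = n + (0 + 1) + n + 1 + 1 + 1 by ring,
      ui_succ (n + (0 + 1) + n + 1 + 1)]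
    ring
  · rw [if_pos (by omega), if_pos (by omega), show n + (d + 1 + 1) + 1 - (n + 1) = d + 2 by omega,
      show n + (d + 1 + 1) - n = d + 2 by omega,
      show n + (d + 1 + 1) - (n + 1) = d + 1 by omega, 
      show n + (d + 1 + 1) - (n + 2) = d by omega, ui_succ d, ui_succ (d + 1),
      ui_succ (n + (d + 1 + 1) + n + 1),  ui_succ (n + (d + 1 + 1) + (n + 1) + 1), 
      show n + (d + 1 + 1) + 1 + (n + 1) + 1 = n + (d + 1 + 1) + n + 1 + 1 + 1 by ring,
      show n + (d + 1 + 1) + (n + 1) + 1 + 1 = n + (d + 1 + 1) + n + 1 + 1 + 1 by ring,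
      show n + (d + 1 + 1) + (n + 2) + 1 = n + (d + 1 + 1) + n + 1 + 1 + 1 by ring,
      ui_succ (n + (d + 1 + 1) + n + 1 + 1)]
    ring

lemma cj_rec_zero (N : ℕ) :
    cj (N + 1) 0 = (1 + X ^ (2 * N + 2)) * cj N 0 + X ^ (N + 1) * cj N 0
      + X ^ (N + 2) * cj N 1 := by
  have hp : pr 1 (2 * (N + 1) + 1) = pr 1 (2 * N + 1) * (1 - X ^ (2 * N + 2)) * (1 - X ^ (2 * N + 3)) := by
    rw [show 2 * (N + 1) + 1 = 2 * N + 1 + 1 + 1 by ring, pr_succ, pr_succ]; simp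
  unfold cj
  rw [if_pos (by omega), if_pos (by omega), hp]
  rcases N with _ | N
  · rw [if_neg (by omega)]
    simp only [Nat.sub_zero, zero_add, mul_zero, add_zero]
    rw [ui_succ 1, ui_succ 0, ui_succ 1]
    simp only [Nat.reduceAdd]
    ring
  · rw [if_pos (by omega)]
    simp only [Nat.sub_zero, add_zero, Nat.add_sub_cancel]
    rw [ui_succ N, ui_succ (N + 1), ui_succ (N + 1 + 1)]
    ring

/-- symmetric geometric sums -/
noncomputable def sig (z : ℂ) : ℕ → ℂ
  | 0 => 1
  | n + 1 => sig z n + z ^ (n + 1) + z⁻¹ ^ (n + 1)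

lemma sig_rec (z : ℂ) (hz : z ≠ 0) (n : ℕ) :
    (z + z⁻¹) * sig z (n + 1) = sig z (n + 2) + sig z n := by
  have hi : z * z⁻¹ = 1 := mul_inv_cancel₀ hz
  induction n with
  | zero => simp only [sig]; linear_combination (2 : ℂ) * hi
  | succ n ih =>
    have e1 : sig z (n + 1 + 2) = sig z (n + 2) + z ^ (n + 3) + z⁻¹ ^ (n + 3) := rfl
    have e2 : sig z (n + 1 + 1) = sig z (n + 1) + z ^ (n + 2) + z⁻¹ ^ (n + 2) := rfl
    have e3 : sig z (n + 1) = sig z n + z ^ (n + 1) + z⁻¹ ^ (n + 1) := rfl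
    rw [e1]
    linear_combination (z + z⁻¹) * e2 + ih - e3 + (z ^ (n + 1) + z⁻¹ ^ (n + 1)) * hi

lemma sig_rec0 (z : ℂ) : (z + z⁻¹) * sig z 0 = sig z 1 - sig z 0 := by
  simp [sig]; ring

lemma tri_succ (n : ℕ) : (n + 1) * (n + 1 + 1) / 2 = n * (n + 1) / 2 + (n + 1) := by
  rw [show (n + 1) * (n + 1 + 1) = n * (n + 1) + (n + 1) * 2 by ring,
    Nat.add_mul_div_right _ _ two_pos]

/-- signed triangular monomials -/
noncomputable def aj (n : ℕ) : ℂ⟦X⟧ := (-1) ^ n * X ^ (n * (n + 1) / 2)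

lemma aj_succ (n : ℕ) : aj (n + 1) = - aj n * X ^ (n + 1) := by
  rw [aj, tri_succ, pow_add, pow_succ, aj]; ring

lemma cj_zero_of_lt {N n : ℕ} (h : N < n) : cj N n = 0 := if_neg (by omega)

lemma finite_jtp (z : ℂ) (hz : z ≠ 0) (N : ℕ) :
    pr z N * pr z⁻¹ N = ∑ n ∈ Finset.range (N + 1), aj n * C (sig z n) * cj N n := by
  induction N with
  | zero =>
    have h0 := pr_ui 0
    rw [pr_zero, one_mul] at h0
    simp [pr_zero, aj, sig, cj, h0, pr_ui 1]
  | succ N ih =>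
    have hi : z * z⁻¹ = 1 := mul_inv_cancel₀ hz
    have hC : (C z * C z⁻¹ : ℂ⟦X⟧) = 1 := by rw [← map_mul, hi, map_one]
    have e1 : pr z (N + 1) * pr z⁻¹ (N + 1) =
        (pr z N * pr z⁻¹ N) * (1 + X ^ (2 * N + 2)) - X ^ (N + 1) * (C (z + z⁻¹) * (pr z N * pr z⁻¹ N)) := by
      rw [pr_succ, pr_succ, map_add]
      linear_combination (pr z N * pr z⁻¹ N * X ^ (2 * N + 2)) * hC
    have e2 : C (z + z⁻¹) * (pr z N * pr z⁻¹ N) =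
        ∑ n ∈ Finset.range N, aj (n + 1) * (C (sig z (n + 2)) + C (sig z n)) * cj N (n + 1)
          + (C (sig z 1) - C (sig z 0)) * cj N 0 := by
      rw [ih, Finset.sum_range_succ', mul_add, Finset.mul_sum]
      congr 1
      · apply Finset.sum_congr rfl
        intro n _
        rw [← map_add, ← sig_rec z hz, map_mul]; ring
      · rw [← map_sub, ← sig_rec0, map_mul]; simp [aj]; ring
    have e3 : ∑ n ∈ Finset.range (N + 1), aj n * C (sig z (n + 1)) * cj N n =
        ∑ n ∈ Finset.range N, aj (n + 1) * C (sig z (n + 2)) * cj N (n + 1) + C (sig z 1) * cj N 0 := by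
      rw [Finset.sum_range_succ']; simp [aj]
    have e4 : ∑ n ∈ Finset.range (N + 1), aj (n + 1) * C (sig z n) * cj N (n + 1) =
        ∑ n ∈ Finset.range N, aj (n + 1) * C (sig z n) * cj N (n + 1) := by
      rw [Finset.sum_range_succ, cj_zero_of_lt (Nat.lt_succ_self N), mul_zero, add_zero]
    have e5 : ∑ n ∈ Finset.range (N + 1), aj (n + 1) * C (sig z (n + 1)) * cj N (n + 1) =
        pr z N * pr z⁻¹ N - cj N 0 := by
      rw [ih, Finset.sum_range_succ, Finset.sum_range_succ' _ N, cj_zero_of_lt (Nat.lt_succ_self N)]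
      simp [aj, sig]
    have e6 : ∑ n ∈ Finset.range (N + 1), aj (n + 2) * C (sig z (n + 1)) * cj N (n + 2) =
        ∑ n ∈ Finset.range (N + 1), aj (n + 1) * C (sig z n) * cj N (n + 1)
          + X * cj N 1 := by
      rw [e4]
      rcases N with _ | N
      · simp [cj_zero_of_lt]
      · rw [Finset.sum_range_succ, Finset.sum_range_succ, Finset.sum_range_succ' _ N,
          cj_zero_of_lt (show N + 1 < N + 1 + 2 by omega), cj_zero_of_lt (show N + 1 < N + 2 by omega)]
        simp [aj, sig]
    rw [e1, e2, Finset.sum_range_succ', cj_rec_zero]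
    have e7 : ∑ n ∈ Finset.range (N + 1), aj (n + 1) * C (sig z (n + 1)) * cj (N + 1) (n + 1) =
        (1 + X ^ (2 * N + 2)) * (∑ n ∈ Finset.range (N + 1), aj (n + 1) * C (sig z (n + 1)) * cj N (n + 1))
        - X ^ (N + 1) * (∑ n ∈ Finset.range (N + 1), aj n * C (sig z (n + 1)) * cj N n)
        - X ^ (N + 1) * (∑ n ∈ Finset.range (N + 1), aj (n + 2) * C (sig z (n + 1)) * cj N (n + 2)) := by
      rw [Finset.mul_sum, Finset.mul_sum, Finset.mul_sum, ← Finset.sum_sub_distrib, ← Finset.sum_sub_distrib]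
      apply Finset.sum_congr rfl
      intro n hn
      have hn : n < N + 1 := Finset.mem_range.1 hn
      rw [cj_rec_succ N n hn, aj_succ (n + 1), aj_succ n]
      have : (X : ℂ⟦X⟧) ^ (N + 1) = X ^ (N - n) * X ^ (n + 1) := by
        rw [← pow_add]; congr 1; omega
      rw [this]
      have h3 : (X : ℂ⟦X⟧) ^ (N + n + 3) = X ^ (N - n) * X ^ (n + 1) * X ^ (n + 2) := by
        rw [← pow_add, ← pow_add]; congr 1; omega
      rw [h3]
      ring
    rw [e7, e5, e6, e4, e3]
    simp only [mul_add, add_mul, Finset.sum_add_distrib]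
    simp only [aj, sig, map_one]
    simp
    ring

lemma pr_dvd (c : ℂ) {N M : ℕ} (h : N ≤ M) : (X : ℂ⟦X⟧) ^ (N + 1) ∣ pr c M - Ph c :=
  (pow_dvd_pow _ (by omega)).trans (phW_dvd _ M)

lemma cj_lim (N n : ℕ) (h : n ≤ N) : (X : ℂ⟦X⟧) ^ (N - n + 1) ∣ Ph 1 * cj N n - 1 := by
  have h1 := pr_dvd 1 (show N - n ≤ N - n by omega)
  have h2 := pr_dvd 1 (show N - n ≤ N + n + 1 by omega)
  have h3 := pr_dvd 1 (show N - n ≤ 2 * N + 1 by omega)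
  have hg : gfW (fun _ => 1) * Ph 1 = 1 := gfW_mul _
  have hc : cj N n * (pr 1 (N - n) * pr 1 (N + n + 1)) = pr 1 (2 * N + 1) := by
    rw [cj, if_pos h]
    linear_combination (pr 1 (2 * N + 1) * (pr 1 (N + n + 1) * ui (N + n + 1))) * pr_ui (N - n) +
      pr 1 (2 * N + 1) * pr_ui (N + n + 1)
  obtain ⟨a, ha⟩ := h1
  obtain ⟨b, hb⟩ := h2
  obtain ⟨d, hd⟩ := h3
  refine ⟨gfW (fun _ => 1) * (d - cj N n * a * pr 1 (N + n + 1) - cj N n * Ph 1 * b), ?_⟩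
  linear_combination (-(Ph 1 * cj N n) + 1) * hg + gfW (fun _ => 1) * (- cj N n * pr 1 (N + n + 1) * ha
    - cj N n * Ph 1 * hb + hd + hc)

lemma jtp (z : ℂ) (hz : z ≠ 0) :
    Ph 1 * Ph z * Ph z⁻¹ = tri (fun n => (-1) ^ n * sig z n) := by
  have h1 := ((lim_pr z).mul (lim_pr z⁻¹)).const_mul (Ph 1)
  rw [mul_assoc]
  refine tendsto_nhds_unique h1 (lim_of_dvd fun N => (pow_dvd_pow _ (Nat.le_succ N)).trans ?_)
  rw [finite_jtp z hz]
  have h2 := tri_dvd (fun n => (-1) ^ n * sig z n) N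
  have h3 : (X : ℂ⟦X⟧) ^ (N + 1) ∣ Ph 1 * ∑ n ∈ Finset.range (N + 1), aj n * C (sig z n) * cj N n -
      ∑ m ∈ Finset.range (N + 1), C ((-1) ^ m * sig z m) * X ^ (m * (m + 1) / 2) := by
    rw [Finset.mul_sum, ← Finset.sum_sub_distrib]
    apply Finset.dvd_sum
    intro n hn
    have hn : n < N + 1 := Finset.mem_range.1 hn
    have h4 := cj_lim N n (by omega)
    have h5 : (X : ℂ⟦X⟧) ^ n ∣ X ^ (n * (n + 1) / 2) := pow_dvd_pow _ (le_tri n)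
    have h6 := mul_dvd_mul h4 h5
    rw [← pow_add, show N - n + 1 + n = N + 1 by omega] at h6
    obtain ⟨e, he⟩ := h6
    refine ⟨e * ((-1) ^ n * C (sig z n)), ?_⟩
    rw [aj]
    simp only [map_mul, map_pow, map_neg, map_one]
    linear_combination ((-1) ^ n * C (sig z n)) * he
  have := dvd_add h3 h2
  simpa using this

end JTPpart
section SpecPart
open PowerSeries Filter Topology
open scoped PowerSeries.WithPiTopology

lemma coeff_expand_tri_mul (k : ℕ) (hk : k ≠ 0) (f : ℕ → ℂ) (G : ℂ⟦X⟧) (n : ℕ) :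
    coeff n (expand k hk (tri f) * G) = ∑ m ∈ Finset.range (n + 1),
      f m * (if k * (m * (m + 1) / 2) ≤ n then coeff (n - k * (m * (m + 1) / 2)) G else 0) := by
  have h0 := (map_dvd (expand k hk) (tri_dvd f n)).mul_right G
  rw [map_pow, expand_X, ← pow_mul] at h0
  have h := (pow_dvd_pow X (Nat.le_mul_of_pos_left _ (Nat.pos_of_ne_zero hk))).trans h0
  rw [map_sub, sub_mul] at h
  have h2 := X_pow_dvd_iff.1 h n (Nat.lt_succ_self n)
  rw [map_sub, sub_eq_zero] at h2
  rw [← h2, map_sum, Finset.sum_mul, map_sum]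
  apply Finset.sum_congr rfl
  intro m _
  rw [map_mul (expand k hk), expand_C, map_pow, expand_X, ← pow_mul, mul_assoc, coeff_C_mul, coeff_X_pow_mul']

lemma rescale_tri (a : ℂ) (f : ℕ → ℂ) :
    rescale a (tri f) = tri (fun m => a ^ (m * (m + 1) / 2) * f m) := by
  ext n
  rw [coeff_rescale, tri, tri, coeff_mk, coeff_mk, Finset.mul_sum]
  apply Finset.sum_congr rfl
  intro m _
  split_ifs with h
  · rw [h]
  · simp

lemma tri_sub (f g : ℕ → ℂ) : tri f - tri g = tri (fun m => f m - g m) := by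
  ext n
  rw [map_sub, tri, tri, tri, coeff_mk, coeff_mk, coeff_mk, ← Finset.sum_sub_distrib]
  apply Finset.sum_congr rfl
  intro m _
  split_ifs <;> simp

lemma C_mul_tri (a : ℂ) (f : ℕ → ℂ) : C a * tri f = tri (fun m => a * f m) := by
  ext n
  rw [coeff_C_mul, tri, tri, coeff_mk, coeff_mk, Finset.mul_sum]
  apply Finset.sum_congr rfl
  intro m _
  split_ifs <;> simp

lemma tri_congr {f g : ℕ → ℂ} (h : ∀ m, f m = g m) : tri f = tri g := by
  rw [funext h]

lemma jtp_one : tri (fun n => (-1) ^ n * (2 * (n : ℂ) + 1)) = Ph 1 ^ 3 := by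
  have h := jtp 1 one_ne_zero
  rw [inv_one] at h
  rw [pow_succ, pow_two, h]
  apply tri_congr
  intro m
  congr 1
  induction m with
  | zero => simp [sig]
  | succ m ih => rw [sig, ← ih]; push_cast; simp; ring

lemma jtp_neg_one : tri (fun _ => 1) = Ph 1 * Ph (-1) ^ 2 := by
  have h := jtp (-1) (by norm_num)
  rw [inv_neg, inv_one] at h
  rw [pow_two, ← mul_assoc, h]
  apply tri_congr
  intro m
  have : sig (-1) m = (-1) ^ m := by
    induction m with
    | zero => simp [sig]
    | succ m ih => rw [sig, ih]; rw [inv_neg, inv_one]; ring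
  rw [this, ← mul_pow]; simp

lemma neg_one_pow_tri (m : ℕ) : ((-1) ^ m * sig Complex.I m : ℂ) = (-1) ^ (m * (m + 1) / 2) ∧
    ((-1) ^ (m + 1) * sig Complex.I (m + 1) : ℂ) = (-1) ^ ((m + 1) * (m + 1 + 1) / 2) := by
  induction m with
  | zero => simp [sig]
  | succ m ih =>
    refine ⟨ih.2, ?_⟩
    have h := sig_rec Complex.I Complex.I_ne_zero m
    rw [Complex.inv_I, add_neg_cancel, zero_mul] at h
    have h2 : sig Complex.I (m + 1 + 1) = - sig Complex.I m := by linear_combination -h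
    rw [h2, tri_succ (m + 1), tri_succ m, pow_add _ (m * (m + 1) / 2 + (m + 1)),
      pow_add _ (m * (m + 1) / 2), ← ih.1]
    have : ((-1 : ℂ) ^ m) ^ 2 = 1 := by rw [← pow_mul, mul_comm, pow_mul]; simp
    linear_combination ((-1 : ℂ) ^ m * sig Complex.I m) * this

lemma jtp_I : tri (fun m => (-1) ^ (m * (m + 1) / 2)) = Ph 1 * expand 2 two_ne_zero (Ph (-1)) := by
  have h := jtp Complex.I Complex.I_ne_zero
  rw [Complex.inv_I, mul_assoc, Ph_mul_neg, Complex.I_sq] at h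
  rw [h]
  apply tri_congr
  intro m
  exact (neg_one_pow_tri m).1.symm

lemma rescale_neg_expand (F : ℂ⟦X⟧) :
    rescale (-1) (expand 2 two_ne_zero F) = expand 2 two_ne_zero F := by
  ext n
  rw [coeff_rescale, coeff_expand]
  split_ifs with h
  · obtain ⟨k, rfl⟩ := h
    rw [pow_mul]; simp
  · simp

lemma rescale_I_expand (F : ℂ⟦X⟧) :
    rescale Complex.I (expand 2 two_ne_zero F) = expand 2 two_ne_zero (rescale (-1) F) := by
  ext n
  rw [coeff_rescale, coeff_expand, coeff_expand]
  split_ifs with h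
  · obtain ⟨k, rfl⟩ := h
    rw [pow_mul, Complex.I_sq, coeff_rescale]; simp
  · simp

lemma Ph_neg_rescale : rescale (-1) (Ph (-1)) * Ph (-1) = expand 2 two_ne_zero (Ph (-1)) := by
  have h1 : rescale (-1) (tri (fun _ => 1)) = Ph 1 * expand 2 two_ne_zero (Ph (-1)) := by
    rw [rescale_tri, ← jtp_I]; simp
  rw [jtp_neg_one, map_mul, map_pow] at h1
  have h2 := Ph_mul_neg 1
  rw [one_pow] at h2
  have h3 := congrArg (rescale (-1 : ℂ)) h2
  rw [rescale_neg_expand, map_mul, ← h2] at h3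
  apply mul_left_cancel₀ (Ph_ne 1)
  rw [← h1]
  linear_combination -(rescale (-1 : ℂ) (Ph (-1))) * h3

end SpecPart
section RankSeries
open PowerSeries Filter Topology
open scoped PowerSeries.WithPiTopology

noncomputable def Rs : ℂ⟦X⟧ := mk fun n => ((rr 0 n - rr 4 n : ℤ) : ℂ)
noncomputable def As : ℂ⟦X⟧ := mk fun n => ((Aa n : ℤ) : ℂ)
noncomputable def Th : ℂ⟦X⟧ := tri fun m => (eps m : ℂ)
noncomputable def Od : ℂ⟦X⟧ := tri fun m => (odi m : ℂ)
noncomputable def Pg : ℂ⟦X⟧ := gfW fun _ => 1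

lemma Pg_mul : Pg * Ph 1 = 1 := gfW_mul _

lemma coeff_Pg (n : ℕ) : coeff n Pg = ((pp n : ℤ) : ℂ) := by
  rw [Pg, gfW, coeff_mk, pp, if_pos (by omega)]
  simp

lemma ser_R1 : expand 4 four_ne_zero (tri fun _ => 1) * Rs + Th * As =
    rescale (-1) (expand 4 four_ne_zero (tri fun _ => 1) * Rs + Th * As) := by
  ext n
  rw [coeff_rescale]
  rcases Nat.even_or_odd n with h | h
  · rw [h.neg_one_pow, one_mul]
  · have h2 := rank_R1 n (Nat.odd_iff.1 h)
    have h3 : coeff n (expand 4 four_ne_zero (tri fun _ => 1) * Rs + Th * As) = 0 := by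
      rw [map_add, coeff_expand_tri_mul, Th, coeff_tri_mul]
      have h4 := congrArg (Int.cast : ℤ → ℂ) h2
      rw [Int.cast_neg, Int.cast_sum, Int.cast_sum] at h4
      rw [eq_neg_iff_add_eq_zero] at h4
      refine Eq.trans ?_ h4
      congr 1
      · apply Finset.sum_congr rfl
        intro m _
        have := tri_cast m
        rw [one_mul]
        split_ifs with hh
        · rw [Rs, coeff_mk, Nat.cast_sub hh, ← this]
          push_cast
          ring_nf
        · generalize m * (m + 1) / 2 = T at *
          rw [rr_nonpos, rr_nonpos]; simp
          all_goals (rw [← this]; omega)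
      · apply Finset.sum_congr rfl
        intro m _
        rw [Int.cast_mul]
        congr 1
        split_ifs with hh
        · rw [As, coeff_mk, Nat.cast_sub hh]
        · generalize m * (m + 1) / 2 = T at *
          rw [Aa_neg]; simp
          omega
    rw [h3, mul_zero]

lemma ser_R2 : expand 4 four_ne_zero (Ph 1 ^ 3) * Pg + Od * As =
    rescale (-1) (expand 4 four_ne_zero (Ph 1 ^ 3) * Pg + Od * As) := by
  rw [← jtp_one]
  ext n
  rw [coeff_rescale]
  rcases Nat.even_or_odd n with h | h
  · rw [h.neg_one_pow, one_mul]
  · have h2 := rank_R2 n (Nat.odd_iff.1 h)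
    have h3 : coeff n (expand 4 four_ne_zero (tri (fun n => (-1) ^ n * (2 * (n : ℂ) + 1))) * Pg + Od * As) = 0 := by
      rw [map_add, coeff_expand_tri_mul, Od, coeff_tri_mul, add_comm]
      have h4 := congrArg (Int.cast : ℤ → ℂ) h2
      rw [Int.cast_neg, Int.cast_sum, Int.cast_sum] at h4
      rw [eq_neg_iff_add_eq_zero] at h4
      refine Eq.trans ?_ h4
      congr 1
      · apply Finset.sum_congr rfl
        intro m _
        rw [Int.cast_mul]
        congr 1
        split_ifs with hh
        · rw [As, coeff_mk, Nat.cast_sub hh]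
        · generalize m * (m + 1) / 2 = T at *
          rw [Aa_neg]; simp
          omega
      · apply Finset.sum_congr rfl
        intro m _
        have := tri_cast m
        rw [Int.cast_mul]
        congr 1
        · push_cast; rfl
        split_ifs with hh
        · rw [coeff_Pg, Nat.cast_sub hh, ← this]
          push_cast
          ring_nf
        · generalize m * (m + 1) / 2 = T at *
          rw [pp, if_neg]; simp
          rw [← this]; omega
    rw [h3, mul_zero]

lemma expand4 (F : ℂ⟦X⟧) : expand 4 four_ne_zero F = expand 2 two_ne_zero (expand 2 two_ne_zero F) := by
  ext n
  simp only [coeff_expand]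
  by_cases h : 4 ∣ n
  · rw [if_pos h, if_pos (by omega), if_pos (by omega)]
    rw [Nat.div_div_eq_div_mul]
  · rw [if_neg h]
    split_ifs
    · omega
    all_goals rfl

lemma neg_one_tri (m : ℕ) : (-1 : ℂ) ^ (m * (m + 1) / 2) = 1 - 2 * (odi m : ℂ) := by
  have h := tri_parity m
  unfold odi
  split_ifs at h ⊢ with h1
  · rw [Odd.neg_one_pow (Nat.odd_iff.2 h)]; norm_num
  · rw [Even.neg_one_pow (Nat.even_iff.2 h)]; norm_num

lemma odi_neg (m : ℕ) : (-1 : ℂ) ^ (m * (m + 1) / 2) * (odi m : ℂ) = - (odi m : ℂ) := by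
  rw [neg_one_tri]; unfold odi; split_ifs <;> norm_num

lemma eps_neg (m : ℕ) : (-1 : ℂ) ^ (m * (m + 1) / 2) * (eps m : ℂ) = - (eps m : ℂ) := by
  rw [neg_one_tri]; unfold odi eps
  split_ifs <;> first | (exfalso; omega) | norm_num

lemma tri_neg (f : ℕ → ℂ) : tri (fun m => - f m) = - tri f := by
  have := C_mul_tri (-1) f
  simp only [map_neg, map_one, neg_mul, one_mul] at this
  exact this.symm

lemma Th_neg : rescale (-1) Th = - Th := by
  rw [Th, rescale_tri, ← tri_neg]
  exact tri_congr eps_neg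

lemma Od_neg : rescale (-1) Od = - Od := by
  rw [Od, rescale_tri, ← tri_neg]
  exact tri_congr odi_neg

lemma psi_sub : tri (fun _ => 1) - rescale (-1) (tri fun _ => 1) = C 2 * Od := by
  rw [rescale_tri, tri_sub, Od, C_mul_tri]
  apply tri_congr
  intro m
  rw [neg_one_tri]; ring

lemma Od_ne : Od ≠ 0 := by
  intro h
  have := congrArg (coeff 1) h
  rw [Od, tri, coeff_mk] at this
  simp [Finset.sum_range_succ, odi] at this

/-- `(q²;q²)`-type abbreviation -/
noncomputable def Lam : ℂ⟦X⟧ := rescale Complex.I (expand 2 two_ne_zero (Ph (-1)))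

lemma Lam_mul : Lam * expand 2 two_ne_zero (Ph (-1)) = expand 4 four_ne_zero (Ph (-1)) := by
  rw [Lam, rescale_I_expand, ← map_mul, Ph_neg_rescale, expand4]

lemma Ph_exp_ne (c : ℂ) : expand 2 two_ne_zero (Ph c) ≠ 0 := by
  intro h
  have := congrArg (coeff (2 * 0)) h
  rw [coeff_expand_mul, coeff0_Ph] at this
  simp at this

lemma ring_aux {R : Type*} [CommRing R] (Od w S S' T J A A' P P' D two : R)
    (h1 : w * S + T * A = w * S' + -T * A') (h2 : J * P + Od * A = J * P' + -Od * A')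
    (hd : P - P' = two * Od * D ^ 2) :
    Od * (w * (S - S')) = Od * (two * T * J * D ^ 2) := by
  linear_combination Od * h1 - T * h2 + T * J * hd

lemma ser_R : Lam ^ 2 * (Rs - rescale (-1) Rs) = C 2 * Th := by
  have h1 := ser_R1
  have h2 := ser_R2
  have x1 : ∀ F : ℂ⟦X⟧, rescale (-1) (expand 4 four_ne_zero F) = expand 4 four_ne_zero F := by
    intro F; rw [expand4, rescale_neg_expand]
  rw [map_add, map_mul, map_mul, x1, Th_neg] at h1
  rw [map_add, map_mul, map_mul, x1, Od_neg] at h2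
  have hP : Pg = tri (fun _ => 1) * (expand 2 two_ne_zero Pg) ^ 2 := by
    apply mul_right_cancel₀ (Ph_ne 1)
    have e := Ph_mul_neg 1
    rw [one_pow] at e
    have f := congrArg (expand 2 two_ne_zero) Pg_mul
    rw [map_mul, map_one, ← e] at f
    rw [Pg_mul, jtp_neg_one]
    linear_combination (- (expand 2 two_ne_zero Pg * (Ph 1 * Ph (-1))) - 1) * f
  have hP' := congrArg (rescale (-1 : ℂ)) hP
  rw [map_mul, map_pow, rescale_neg_expand] at hP'
  have hp := psi_sub
  set w := expand 4 four_ne_zero (tri fun _ => 1) with hw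
  have hw2 : w = expand 4 four_ne_zero (Ph 1) * expand 4 four_ne_zero (Ph (-1)) ^ 2 := by
    rw [hw, jtp_neg_one, map_mul, map_pow]
  have hd : Pg - rescale (-1) Pg = C 2 * Od * (expand 2 two_ne_zero Pg) ^ 2 := by
    linear_combination hP - hP' + (expand 2 two_ne_zero Pg) ^ 2 * hp
  have k1 : w * (Rs - rescale (-1) Rs) = C 2 * Th * expand 4 four_ne_zero (Ph 1 ^ 3) * (expand 2 two_ne_zero Pg) ^ 2 := by
    apply mul_left_cancel₀ Od_ne
    exact ring_aux _ _ _ _ _ _ _ _ _ _ _ _ h1 h2 hd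
  have k2 : expand 4 four_ne_zero (Ph 1) * expand 2 two_ne_zero Pg = expand 2 two_ne_zero (Ph (-1)) := by
    rw [expand4, ← map_mul]
    refine congrArg (expand 2 two_ne_zero) ?_
    have e := Ph_mul_neg 1
    rw [one_pow] at e
    rw [← e]
    linear_combination Ph (-1) * Pg_mul
  have n4 : expand 4 four_ne_zero (Ph 1) ≠ 0 := by
    rw [expand4]
    intro h
    have := congrArg (coeff (2 * (2 * 0))) h
    rw [coeff_expand_mul, coeff_expand_mul, coeff0_Ph] at this
    simp at this
  apply mul_left_cancel₀ n4
  apply mul_left_cancel₀ (pow_ne_zero 2 (Ph_exp_ne (-1)))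
  rw [hw2, ← Lam_mul, map_pow] at k1
  rw [← k2] at k1 ⊢
  linear_combination k1

lemma I_tri (m : ℕ) : (-Complex.I) ^ (m * (m + 1) / 2) - Complex.I ^ (m * (m + 1) / 2) =
    -2 * Complex.I * (eps m : ℂ) := by
  obtain ⟨q, r, hr, rfl⟩ : ∃ q r, r < 8 ∧ m = 8 * q + r := ⟨m / 8, m % 8, by omega, by omega⟩
  have hI : Complex.I ^ 4 = 1 := Complex.I_pow_four
  have hI' : (-Complex.I) ^ 4 = 1 := by rw [neg_pow, hI]; norm_num
  have key : ∀ s t : ℕ, (8 * q + r) * (8 * q + r + 1) = 2 * (4 * s + t) →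
      (-Complex.I) ^ ((8 * q + r) * (8 * q + r + 1) / 2) - Complex.I ^ ((8 * q + r) * (8 * q + r + 1) / 2) =
      (-Complex.I) ^ t - Complex.I ^ t := by
    intro s t h
    rw [h, Nat.mul_div_cancel_left _ two_pos, pow_add, pow_mul, pow_add, pow_mul, hI, hI']; simp
  unfold eps
  rw [show (8 * q + r) % 8 = r by omega]
  have I3 : Complex.I ^ 3 = -Complex.I := Complex.I_pow_three
  interval_cases r
  · rw [key (8 * q * q + q) 0 (by ring)]; norm_num
  · rw [key (8 * q * q + 3 * q) 1 (by ring)]; norm_num; ring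
  · rw [key (8 * q * q + 5 * q) 3 (by ring)]; norm_num
    rw [neg_pow, I3]; ring
  · rw [key (8 * q * q + 7 * q + 1) 2 (by ring)]; norm_num
  · rw [key (8 * q * q + 9 * q + 2) 2 (by ring)]; norm_num
  · rw [key (8 * q * q + 11 * q + 3) 3 (by ring)]; norm_num
    rw [neg_pow, I3]; ring
  · rw [key (8 * q * q + 13 * q + 5) 1 (by ring)]; norm_num; ring
  · rw [key (8 * q * q + 15 * q + 7) 0 (by ring)]; norm_num

/-- Relation between the rank difference and the crank at `z = i`. -/
lemma rank_crank_I (G : ℂ⟦X⟧) (hG : G * (Ph Complex.I * Ph (-Complex.I)) = Ph 1) (n : ℕ) (hn : n % 4 = 1) :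
    coeff n G = - ((rr 0 n - rr 4 n : ℤ) : ℂ) := by
  rw [Ph_mul_neg, Complex.I_sq] at hG
  have h1 : G * expand 2 two_ne_zero (Ph (-1)) ^ 2 = tri (fun m => (-1) ^ (m * (m + 1) / 2)) := by
    rw [jtp_I, ← hG]; ring
  have h2 := congrArg (rescale Complex.I) h1
  rw [map_mul, map_pow, ← Lam, rescale_tri] at h2
  have h3 := congrArg (rescale (-1 : ℂ)) h2
  have hL : rescale (-1) Lam = Lam := by rw [Lam, rescale_I_expand, rescale_neg_expand]
  rw [map_mul, map_pow, hL, rescale_tri] at h3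
  have h4 : (rescale Complex.I G - rescale (-1) (rescale Complex.I G)) * Lam ^ 2 = - C Complex.I * (C 2 * Th) := by
    rw [sub_mul, h2, h3, tri_sub, Th, ← mul_assoc, ← map_neg, ← map_mul, C_mul_tri]
    apply tri_congr
    intro m
    rw [← mul_pow, ← mul_pow]
    simp only [mul_neg, mul_one, neg_mul, one_mul, neg_neg]
    rw [I_tri]; ring
  have hL0 : Lam ≠ 0 := by
    intro h
    have := Lam_mul
    rw [h, zero_mul, expand4] at this
    have := congrArg (coeff (2 * (2 * 0))) this
    rw [coeff_expand_mul, coeff_expand_mul, coeff0_Ph] at this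
    simp at this
  rw [← ser_R] at h4
  have h5 : rescale Complex.I G - rescale (-1) (rescale Complex.I G) = - C Complex.I * (Rs - rescale (-1) Rs) := by
    apply mul_right_cancel₀ (pow_ne_zero 2 hL0)
    rw [h4]; ring
  have h6 := congrArg (coeff n) h5
  rw [← map_neg, coeff_C_mul, map_sub, map_sub, coeff_rescale, coeff_rescale, coeff_rescale, coeff_rescale,
    Odd.neg_one_pow (Nat.odd_iff.2 (by omega)), Rs, coeff_mk] at h6
  obtain ⟨k, rfl⟩ : ∃ k, n = 4 * k + 1 := ⟨n / 4, by omega⟩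
  rw [pow_succ, pow_mul, Complex.I_pow_four, one_pow, one_mul] at h6
  have h7 : (2 * Complex.I) ≠ 0 := by simp
  apply mul_left_cancel₀ h7
  linear_combination h6

end RankSeries
section QBinomial
open PowerSeries Filter Topology
open scoped PowerSeries.WithPiTopology

/-- q-binomial coefficients `(a)_ν/(q)_ν` -/
noncomputable def tq (a : ℂ⟦X⟧) (ν : ℕ) : ℂ⟦X⟧ := (∏ k ∈ Finset.range ν, (1 - a * X ^ k)) * ui ν

lemma tq_zero (a : ℂ⟦X⟧) : tq a 0 = 1 := by
  have h0 := pr_ui 0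
  rw [pr_zero, one_mul] at h0
  simp [tq, h0]

lemma tq_succ (a : ℂ⟦X⟧) (ν : ℕ) : tq a (ν + 1) * (1 - X ^ (ν + 1)) = tq a ν * (1 - a * X ^ ν) := by
  rw [tq, tq, Finset.prod_range_succ, ui_succ ν]; ring

lemma tq_fun (a x : ℂ⟦X⟧) (N : ℕ) :
    (1 - x) * (∑ ν ∈ Finset.range (N + 1), tq a ν * x ^ ν) + tq a N * (1 - a * X ^ N) * x ^ (N + 1) =
    (1 - a * x) * (∑ ν ∈ Finset.range (N + 1), tq a ν * (x * X) ^ ν) := by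
  induction N with
  | zero => simp [tq_zero]; ring
  | succ N ih =>
    rw [Finset.sum_range_succ, Finset.sum_range_succ _ (N + 1), mul_add, mul_add, ← ih]
    linear_combination x ^ (N + 1) * tq_succ a N

lemma tq_iter (a : ℂ⟦X⟧) (b : ℂ) (N M : ℕ) :
    (X : ℂ⟦X⟧) ^ (N + 1) ∣ pr b M * (∑ ν ∈ Finset.range (N + 1), tq a ν * (C b * X) ^ ν) -
      (∏ k ∈ Finset.range M, (1 - a * C b * X ^ (k + 1))) *
        (∑ ν ∈ Finset.range (N + 1), tq a ν * (C b * X ^ (M + 1)) ^ ν) := by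
  induction M with
  | zero => simp [pr_zero]
  | succ M ih =>
    obtain ⟨e, he⟩ := ih
    have h := tq_fun a (C b * X ^ (M + 1)) N
    rw [pr_succ, Finset.prod_range_succ]
    rw [show (C b * X ^ (M + 1) * X : ℂ⟦X⟧) = C b * X ^ (M + 1 + 1) by ring] at h
    refine ⟨(1 - C b * X ^ (M + 1)) * e -
      (∏ k ∈ Finset.range M, (1 - a * C b * X ^ (k + 1))) * (tq a N * (1 - a * X ^ N) *
        (C b ^ (N + 1) * (X ^ M) ^ (N + 1))), ?_⟩
    have h3 : (C b * X ^ (M + 1) : ℂ⟦X⟧) ^ (N + 1) = X ^ (N + 1) * (C b ^ (N + 1) * (X ^ M) ^ (N + 1)) := by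
      rw [mul_pow, ← pow_mul, ← pow_mul]; ring
    rw [h3] at h
    linear_combination (1 - C b * X ^ (M + 1)) * he +
      (∏ k ∈ Finset.range M, (1 - a * C b * X ^ (k + 1))) * h

lemma tq_final (a : ℂ⟦X⟧) (b : ℂ) (N : ℕ) :
    (X : ℂ⟦X⟧) ^ (N + 1) ∣ pr b N * (∑ ν ∈ Finset.range (N + 1), tq a ν * (C b * X) ^ ν) -
      (∏ k ∈ Finset.range N, (1 - a * C b * X ^ (k + 1))) := by
  have h1 := tq_iter a b N N
  have h2 : (X : ℂ⟦X⟧) ^ (N + 1) ∣ (∑ ν ∈ Finset.range (N + 1), tq a ν * (C b * X ^ (N + 1)) ^ ν) - 1 := by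
    rw [Finset.sum_range_succ']
    simp only [pow_zero, mul_one, tq_zero, add_sub_cancel_right]
    apply Finset.dvd_sum
    intro ν _
    exact ⟨tq a (ν + 1) * C b * (C b * X ^ (N + 1)) ^ ν, by ring⟩
  have h3 := h2.mul_left (∏ k ∈ Finset.range N, (1 - a * C b * X ^ (k + 1)))
  have := dvd_add h1 h3
  convert this using 1
  ring

/-- partial Euler sum -/
noncomputable def En (z : ℂ) (N : ℕ) : ℂ⟦X⟧ := ∑ ν ∈ Finset.range (N + 1), ui ν * (C z * X) ^ ν
/-- partial sum for the ones -/
noncomputable def Kn (z y : ℂ) (N : ℕ) : ℂ⟦X⟧ :=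
  ∑ ν ∈ Finset.range (N + 1), pr z ν * ui ν * (C y * X) ^ ν

lemma lim_En (z : ℂ) : Tendsto (fun N => pr z N * En z N) atTop (𝓝 1) := by
  refine lim_of_dvd fun N => (pow_dvd_pow _ (Nat.le_succ N)).trans ?_
  have := tq_final 0 z N
  simpa [En, tq] using this

lemma lim_Kn (z y : ℂ) (h : z * y = 1) :
    Tendsto (fun N => (1 - X) * (pr y N * Kn z y N)) atTop (𝓝 (Ph 1)) := by
  refine lim_of_dvd fun N => (pow_dvd_pow _ (Nat.le_succ N)).trans ?_
  have h1 := (tq_final (C z * X) y N).mul_left (1 - X)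
  have h2 := pr_dvd 1 (Nat.le_succ N)
  have e : ∀ N, (1 - X : ℂ⟦X⟧) * ∏ k ∈ Finset.range N, (1 - C z * X * C y * X ^ (k + 1)) = pr 1 (N + 1) := by
    intro N
    have hC : (C z * C y : ℂ⟦X⟧) = 1 := by rw [← map_mul, h, map_one]
    induction N with
    | zero => rw [pr_succ, pr_zero]; simp
    | succ N ih =>
      rw [Finset.prod_range_succ, ← mul_assoc, ih, pr_succ _ (N + 1), map_one]
      linear_combination (-pr 1 (N + 1) * X ^ (N + 2)) * hC
  have f : ∀ ν, tq (C z * X) ν = pr z ν * ui ν := by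
    intro ν
    rw [tq, pr, prW]
    congr 1
    apply Finset.prod_congr rfl
    intro k _
    ring
  rw [mul_sub, e] at h1
  simp only [f] at h1
  have := dvd_add h1 h2
  simpa [Kn] using this

end QBinomial
section CrankGF
open PowerSeries Filter Topology
open scoped PowerSeries.WithPiTopology

/-- weights for partitions with all parts in `[2,k]` -/
noncomputable def vk (k x : ℕ) : ℂ := if 2 ≤ x ∧ x ≤ k then 1 else 0
/-- weights for partitions without ones -/
noncomputable def wn (z : ℂ) (ν x : ℕ) : ℂ := if x = 1 then 0 else if x ≤ ν then 1 else z

lemma lim_eventually {f : ℕ → ℂ⟦X⟧} {F : ℂ⟦X⟧} (N0 : ℕ) (h : ∀ N, N0 ≤ N → f N = F) :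
    Tendsto f atTop (𝓝 F) :=
  tendsto_atTop_of_eventually_const (i₀ := N0) h

lemma vk_fin (k M : ℕ) (hk : 1 ≤ k) : (1 - X) * prW (vk k) (M + 1) = pr 1 (min (M + 1) k) := by
  induction M with
  | zero =>
    rw [min_eq_left (by omega), prW_succ, prW_zero, pr_succ, pr_zero]
    simp [vk]
  | succ M ih =>
    rw [prW_succ, ← mul_assoc, ih]
    by_cases h : M + 1 + 1 ≤ k
    · rw [min_eq_left (by omega), min_eq_left h, pr_succ _ (M + 1), vk, if_pos (by omega)]
    · rw [min_eq_right (by omega), min_eq_right (by omega), vk, if_neg (by omega)]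
      simp

lemma gf_vk (k : ℕ) (hk : 1 ≤ k) : gfW (vk k) = (1 - X) * ui k := by
  have h : (1 - X) * phW (vk k) = pr 1 k := by
    refine tendsto_nhds_unique ((lim_prW (vk k)).const_mul (1 - X)) (lim_eventually (k + 1) ?_)
    intro N hN
    obtain ⟨M, rfl⟩ : ∃ M, N = M + 1 := ⟨N - 1, by omega⟩
    rw [vk_fin k M hk, min_eq_right (by omega)]
  have h2 := gfW_mul (vk k)
  have h3 := pr_ui k
  linear_combination (-(1 - X) * ui k) * (-h2) - ((1 - X) * ui k + gfW (vk k) - (1-X) * ui k) * h3 + (ui k * gfW (vk k)) * (-h)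

lemma wn_fin (z : ℂ) (ν j : ℕ) (hν : 1 ≤ ν) :
    prW (wn z ν) (ν + j) * (1 - X) * pr z ν = pr 1 ν * pr z (ν + j) := by
  induction j with
  | zero =>
    rw [add_zero]
    congr 1
    have : ∀ m, m + 1 ≤ ν → prW (wn z ν) (m + 1) * (1 - X) = pr 1 (m + 1) := by
      intro m
      induction m with
      | zero => intro _; rw [prW_succ, prW_zero, pr_succ, pr_zero]; simp [wn]
      | succ m ih =>
        intro hm
        rw [prW_succ, pr_succ, ← ih (by omega), wn, if_neg (by omega), if_pos hm]; ring
    obtain ⟨m, rfl⟩ : ∃ m, ν = m + 1 := ⟨ν - 1, by omega⟩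
    exact this m le_rfl
  | succ j ih =>
    rw [← add_assoc, prW_succ, pr_succ, wn, if_neg (by omega), if_neg (by omega)]
    linear_combination (1 - C z * X ^ (ν + j + 1)) * ih

lemma gf_wn (z : ℂ) (ν : ℕ) (hν : 1 ≤ ν) :
    gfW (wn z ν) * Ph z = (1 - X) * (pr z ν * ui ν) := by
  have h : phW (wn z ν) * (1 - X) * pr z ν = pr 1 ν * Ph z := by
    refine tendsto_nhds_unique (((lim_prW (wn z ν)).mul_const (1 - X)).mul_const (pr z ν)) ?_
    have l2 := (lim_pr z).const_mul (pr 1 ν)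
    refine l2.congr' ?_
    filter_upwards [eventually_ge_atTop ν] with N hN
    obtain ⟨j, rfl⟩ := Nat.exists_eq_add_of_le hN
    exact (wn_fin z ν j hν).symm
  have h2 := gfW_mul (wn z ν)
  have h3 := pr_ui ν
  linear_combination ((1 - X) * pr z ν * ui ν) * h2 - (gfW (wn z ν) * Ph z) * h3 - (ui ν * gfW (wn z ν)) * h

/-- contribution of the partitions with exactly `ν` ones -/
noncomputable def Sn (z : ℂ) (ν : ℕ) : ℂ⟦X⟧ :=
  mk fun n => ∑ p : n.Partition with p.parts.count 1 = ν, z ^ (p.parts.filter (fun x => ν < x)).card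

lemma wn_prod (z : ℂ) (ν : ℕ) (s : Multiset ℕ) : (s.map (wn z ν)).prod =
    if s.count 1 = 0 then z ^ (s.filter (fun x => x ≠ 1 ∧ ν < x)).card else 0 := by
  induction s using Multiset.induction_on with
  | empty => simp
  | cons a s ih =>
    rw [Multiset.map_cons, Multiset.prod_cons, ih, Multiset.count_cons, wn]
    by_cases h1 : a = 1
    · simp [h1]
    · rw [if_neg h1, if_neg (Ne.symm h1), add_zero]
      by_cases h2 : a ≤ ν
      · rw [if_pos h2, one_mul, Multiset.filter_cons_of_neg _ (by omega)]
      · rw [if_neg h2, Multiset.filter_cons_of_pos _ (by omega), Multiset.card_cons]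
        split_ifs
        · ring
        · simp

/-- remove ones -/
def remOnes {m ν : ℕ} (p : (m + ν).Partition) (h : p.parts.count 1 = ν) : m.Partition where
  parts := p.parts.filter (· ≠ 1)
  parts_pos := fun hi => p.parts_pos (Multiset.mem_of_mem_filter hi)
  parts_sum := by
    have h1 := congrArg Multiset.sum (Multiset.filter_add_not (fun x => x = 1) p.parts)
    rw [Multiset.sum_add, p.parts_sum, Multiset.filter_eq', h, Multiset.sum_replicate] at h1
    simp only [smul_eq_mul, mul_one] at h1
    simp only [ne_eq]
    omega

/-- add ones -/
def addOnes {m : ℕ} (ν : ℕ) (p : m.Partition) : (m + ν).Partition where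
  parts := p.parts + Multiset.replicate ν 1
  parts_pos := by
    intro i hi
    rcases Multiset.mem_add.1 hi with h | h
    · exact p.parts_pos h
    · rw [Multiset.eq_of_mem_replicate h]; exact one_pos
  parts_sum := by simp [p.parts_sum]

lemma count_le {n : ℕ} (p : n.Partition) : p.parts.count 1 ≤ n := by
  have h1 := congrArg Multiset.sum (Multiset.filter_add_not (fun x => x = 1) p.parts)
  rw [Multiset.sum_add, p.parts_sum, Multiset.filter_eq', Multiset.sum_replicate] at h1
  simp only [smul_eq_mul, mul_one] at h1
  omega

lemma Sn_eq (z : ℂ) (ν : ℕ) (hν : 1 ≤ ν) : Sn z ν = X ^ ν * gfW (wn z ν) := by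
  ext n
  rw [Sn, coeff_mk, coeff_X_pow_mul']
  split_ifs with h
  · obtain ⟨m, rfl⟩ := Nat.exists_eq_add_of_le' h
    rw [Nat.add_sub_cancel, gfW, coeff_mk]
    simp only [wn_prod]
    rw [← Finset.sum_filter]
    refine Finset.sum_bij' (fun p hp => remOnes p (Finset.mem_filter.1 hp).2) (fun p _ => addOnes ν p) ?_ ?_ ?_ ?_ ?_
    · intro p hp
      simp [remOnes]
    · intro p hp
      rw [Finset.mem_filter] at hp ⊢
      refine ⟨Finset.mem_univ _, ?_⟩
      simp [addOnes, hp.2]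
    · intro p hp
      rw [Finset.mem_filter] at hp
      apply Nat.Partition.ext
      simp only [addOnes, remOnes]
      have h1 := Multiset.filter_add_not (fun x => x = 1) p.parts
      rw [Multiset.filter_eq', hp.2] at h1
      rw [add_comm]; exact h1
    · intro p hp
      rw [Finset.mem_filter] at hp
      apply Nat.Partition.ext
      simp only [addOnes, remOnes, Multiset.filter_add]
      have h2 : (Multiset.replicate ν 1).filter (· ≠ 1) = 0 := by
        rw [Multiset.filter_eq_nil]
        intro a ha
        rw [Multiset.eq_of_mem_replicate ha]; simp
      rw [h2, add_zero, Multiset.filter_eq_self]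
      intro a ha h3
      subst h3
      exact (Multiset.count_eq_zero.1 hp.2) ha
    · intro p hp
      simp only [remOnes]
      rw [Multiset.filter_filter]
      congr 2
      apply Multiset.filter_congr
      intro x _
      constructor
      · intro hx; omega
      · intro hx; omega
  · apply Finset.sum_eq_zero
    intro p hp
    have := count_le p
    rw [(Finset.mem_filter.1 hp).2] at this
    omega

/-- partitions without ones with largest part `k` -/
noncomputable def hk (k : ℕ) : ℂ⟦X⟧ :=
  mk fun n => ∑ p : n.Partition with p.parts.count 1 = 0 ∧ p.parts.sup = k, 1

lemma vk_prod (k : ℕ) (s : Multiset ℕ) (hs : ∀ x ∈ s, 0 < x) : (s.map (vk k)).prod =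
    if s.count 1 = 0 ∧ s.sup ≤ k then 1 else 0 := by
  induction s using Multiset.induction_on with
  | empty => simp
  | cons a s ih =>
    have ha := hs a (Multiset.mem_cons_self a s)
    rw [Multiset.map_cons, Multiset.prod_cons, ih (fun x hx => hs x (Multiset.mem_cons_of_mem hx)),
      Multiset.count_cons, vk, Multiset.sup_cons]
    by_cases h1 : a = 1
    · simp [h1]
    · rw [if_neg (Ne.symm h1), add_zero, ite_zero_mul_ite_zero, one_mul]
      refine if_congr ?_ rfl rfl
      rw [sup_le_iff]
      constructor
      · rintro ⟨⟨_, h⟩, h2, h3⟩; exact ⟨h2, h, h3⟩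
      · rintro ⟨h2, h, h3⟩; exact ⟨⟨by omega, h⟩, h2, h3⟩

lemma coeff_vk (k n : ℕ) : coeff n (gfW (vk k)) =
    ∑ p : n.Partition, if p.parts.count 1 = 0 ∧ p.parts.sup ≤ k then 1 else 0 := by
  rw [gfW, coeff_mk]
  apply Finset.sum_congr rfl
  intro p _
  exact vk_prod k _ (fun x hx => p.parts_pos hx)

lemma hk_succ (k : ℕ) : hk (k + 1) = gfW (vk (k + 1)) - gfW (vk k) := by
  ext n
  rw [map_sub, coeff_vk, coeff_vk, ← Finset.sum_sub_distrib, hk, coeff_mk, Finset.sum_filter]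
  apply Finset.sum_congr rfl
  intro p _
  split_ifs <;> first | (exfalso; omega) | simp

lemma hk_eq (k : ℕ) (h2 : 2 ≤ k) : hk k = X ^ k * ((1 - X) * ui k) := by
  obtain ⟨m, rfl⟩ : ∃ m, k = m + 1 := ⟨k - 1, by omega⟩
  rw [hk_succ, gf_vk _ (by omega), gf_vk _ (by omega), ui_succ m]
  ring

lemma hk_zero : hk 0 = 1 := by
  have h : hk 0 = gfW (vk 0) := by
    ext n
    rw [coeff_vk, hk, coeff_mk, Finset.sum_filter]
    simp
  have h1 : phW (vk 0) = 1 := by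
    refine tendsto_nhds_unique (lim_prW (vk 0)) (lim_eventually 0 ?_)
    intro N _
    rw [prW]
    apply Finset.prod_eq_one
    intro k _
    rw [vk, if_neg (by omega)]; simp
  have h2 := gfW_mul (vk 0)
  rw [h1, mul_one] at h2
  rw [h, h2]

lemma hk_one : hk 1 = 0 := by
  have h : vk 1 = vk 0 := by
    funext x
    rw [vk, vk, if_neg (by omega), if_neg (by omega)]
  rw [hk_succ, h, sub_self]

end CrankGF
section CrankGF2
open PowerSeries Filter Topology
open scoped PowerSeries.WithPiTopology

/-- crank generating function -/
noncomputable def Cr (z : ℂ) : ℂ⟦X⟧ := mk fun n => ∑ p : n.Partition, z ^ (partitionCrank p)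
/-- part without ones -/
noncomputable def Hs (z : ℂ) : ℂ⟦X⟧ :=
  mk fun n => ∑ p : n.Partition with p.parts.count 1 = 0, z ^ p.parts.sup

lemma sup_le_n {n : ℕ} (p : n.Partition) : p.parts.sup ≤ n := by
  rw [Multiset.sup_le]
  intro b hb
  rw [← p.parts_sum]
  exact Multiset.le_sum_of_mem hb

lemma lim_Hs (z : ℂ) :
    Tendsto (fun N => ∑ k ∈ Finset.range (N + 1), C (z ^ k) * hk k) atTop (𝓝 (Hs z)) := by
  refine lim_of_dvd fun N => X_pow_dvd_iff.2 ?_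
  intro n hn
  rw [map_sub, sub_eq_zero, map_sum, Hs, coeff_mk]
  simp only [coeff_C_mul, hk, coeff_mk]
  simp only [Finset.sum_filter, Finset.mul_sum]
  rw [Finset.sum_comm]
  apply Finset.sum_congr rfl
  intro p _
  have hs := sup_le_n p
  split_ifs with h
  · rw [Finset.sum_eq_single p.parts.sup]
    · simp [h]
    · intro b _ hb
      rw [if_neg (fun hh => hb hh.2.symm), mul_zero]
    · intro hh
      exact absurd (Finset.mem_range.2 (by omega)) hh
  · apply Finset.sum_eq_zero
    intro k _
    rw [if_neg (fun hh => h hh.1), mul_zero]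

lemma lim_Sn (z : ℂ) (hz : z ≠ 0) :
    Tendsto (fun N => ∑ ν ∈ Finset.range N, C (z⁻¹ ^ (ν + 1)) * Sn z (ν + 1)) atTop (𝓝 (Cr z - Hs z)) := by
  refine lim_of_dvd fun N => X_pow_dvd_iff.2 ?_
  intro n hn
  rw [map_sub, map_sub, sub_eq_zero, map_sum, Hs, Cr, coeff_mk, coeff_mk]
  simp only [coeff_C_mul, Sn, coeff_mk]
  simp only [Finset.sum_filter, Finset.mul_sum]
  rw [Finset.sum_comm, ← Finset.sum_sub_distrib]
  apply Finset.sum_congr rfl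
  intro p _
  have hs := count_le p
  rw [partitionCrank]
  split_ifs with h
  · rw [zpow_natCast, sub_self]
    apply Finset.sum_eq_zero
    intro k _
    rw [if_neg (by omega), mul_zero]
  · rw [Finset.sum_eq_single (p.parts.count 1 - 1)]
    · have e : p.parts.count 1 - 1 + 1 = p.parts.count 1 := by omega
      rw [e, if_pos rfl, sub_zero, zpow_sub₀ hz, zpow_natCast, zpow_natCast, inv_pow]
      rw [div_eq_mul_inv, mul_comm]
    · intro b _ hb
      rw [if_neg (by omega), mul_zero]
    · intro hh
      exact absurd (Finset.mem_range.2 (by omega)) hh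

lemma Hs_fin (z : ℂ) (N : ℕ) : ∑ k ∈ Finset.range (N + 1 + 1), C (z ^ k) * hk k =
    (1 - X) * En z (N + 1) + X - C z * X := by
  have h0 := pr_ui 0
  rw [pr_zero, one_mul] at h0
  have h1 := pr_ui 1
  rw [pr_succ, pr_zero] at h1
  simp only [map_one, one_mul, zero_add, pow_one] at h1
  induction N with
  | zero =>
    rw [En]
    simp only [Finset.sum_range_succ, Finset.sum_range_zero, zero_add, hk_zero, hk_one, h0]
    simp only [pow_zero, map_one, mul_zero, add_zero, mul_one, pow_one]
    linear_combination (- C z * X) * h1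
  | succ N ih =>
    rw [Finset.sum_range_succ, ih, hk_eq _ (by omega), En, En, Finset.sum_range_succ _ (N + 1 + 1), map_pow]
    ring

lemma Hs_mul (z : ℂ) : Hs z * Ph z = (1 - X) + (X - C z * X) * Ph z := by
  refine tendsto_nhds_unique ((lim_Hs z).mul (lim_pr z)) ?_
  have l := ((lim_En z).const_mul (1 - X)).add ((lim_pr z).const_mul (X - C z * X))
  rw [mul_one] at l
  refine l.congr' ?_
  filter_upwards [eventually_ge_atTop 1] with N hN
  obtain ⟨M, rfl⟩ : ∃ M, N = M + 1 := ⟨N - 1, by omega⟩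
  rw [Hs_fin]; ring

lemma Sn_fin (z y : ℂ) (N : ℕ) : (∑ ν ∈ Finset.range N, C (y ^ (ν + 1)) * Sn z (ν + 1)) * Ph z =
    (1 - X) * (Kn z y N - 1) := by
  have h0 := pr_ui 0
  rw [pr_zero, one_mul] at h0
  rw [Kn, Finset.sum_range_succ', Finset.sum_mul]
  simp only [pr_zero, h0, pow_zero, mul_one, add_sub_cancel_right]
  rw [Finset.mul_sum]
  apply Finset.sum_congr rfl
  intro ν _
  rw [Sn_eq _ _ (by omega), map_pow]
  linear_combination (C y ^ (ν + 1) * X ^ (ν + 1)) * gf_wn z (ν + 1) (by omega)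

lemma Sn_mul (z : ℂ) (hz : z ≠ 0) : (Cr z - Hs z) * Ph z * Ph z⁻¹ = Ph 1 - (1 - X) * Ph z⁻¹ := by
  refine tendsto_nhds_unique (((lim_Sn z hz).mul_const (Ph z)).mul (lim_pr z⁻¹)) ?_
  have l := (lim_Kn z z⁻¹ (mul_inv_cancel₀ hz)).sub ((lim_pr z⁻¹).const_mul (1 - X))
  refine l.congr ?_
  intro N
  rw [Sn_fin]; ring

lemma Cr_mul (z : ℂ) (hz : z ≠ 0) : (Cr z - (X - C z * X)) * (Ph z * Ph z⁻¹) = Ph 1 := by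
  linear_combination Sn_mul z hz + Ph z⁻¹ * Hs_mul z

end CrankGF2
section FinalPart
open PowerSeries Filter Topology
open scoped PowerSeries.WithPiTopology

lemma coeff_lin (z : ℂ) {n : ℕ} (hn : 2 ≤ n) : coeff n (X - C z * X : ℂ⟦X⟧) = 0 := by
  rw [map_sub, coeff_C_mul, coeff_X, if_neg (by omega)]; simp

lemma Cr_symm (z : ℂ) (hz : z ≠ 0) {n : ℕ} (hn : 2 ≤ n) : coeff n (Cr z) = coeff n (Cr z⁻¹) := by
  have h1 := Cr_mul z hz
  have h2 := Cr_mul z⁻¹ (inv_ne_zero hz)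
  rw [inv_inv, mul_comm (Ph z⁻¹), ← h1] at h2
  have h3 := mul_right_cancel₀ (mul_ne_zero (Ph_ne z) (Ph_ne z⁻¹)) h2
  have h4 := congrArg (coeff n) h3
  have e : ∀ w : ℂ, coeff n (Cr w - (X - C w * X)) = coeff n (Cr w) := by
    intro w; rw [map_sub, coeff_lin _ hn, sub_zero]
  rw [e, e] at h4
  exact h4.symm

lemma Cr_eval (z : ℂ) (hz : z ^ 8 = 1) (n : ℕ) :
    coeff n (Cr z) = ∑ a ∈ Finset.range 8, z ^ a * (crankCount (a : ℤ) 8 n : ℂ) := by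
  have hz0 : z ≠ 0 := by rintro rfl; norm_num at hz
  rw [Cr, coeff_mk]
  have : ∀ a : ℕ, (crankCount (a : ℤ) 8 n : ℂ) =
      ∑ p : n.Partition, if partitionCrank p % 8 = (a : ℤ) % 8 then 1 else 0 := by
    intro a
    rw [crankCount, Finset.card_filter]
    push_cast
    rfl
  simp only [this, Finset.mul_sum]
  rw [Finset.sum_comm]
  apply Finset.sum_congr rfl
  intro p _
  generalize partitionCrank p = c
  have e : z ^ c = z ^ (c % 8).toNat := by
    rw [← zpow_natCast, Int.toNat_of_nonneg (by omega)]
    conv_lhs => rw [← Int.emod_add_mul_ediv c 8]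
    rw [zpow_add₀ hz0, zpow_mul, show z ^ (8 : ℤ) = 1 by exact_mod_cast hz, one_zpow, mul_one]
  rw [e, Finset.sum_eq_single (c % 8).toNat]
  · rw [if_pos (by omega), mul_one]
  · intro b hb hne
    have := Finset.mem_range.1 hb
    rw [if_neg (by omega), mul_zero]
  · intro hh
    exact absurd (Finset.mem_range.2 (by omega)) hh

lemma total_count {n : ℕ} (f : n.Partition → ℤ) :
    ∑ a ∈ Finset.range 8, (Finset.univ.filter (fun p => f p % ((8 : ℕ) : ℤ) = (a : ℤ) % ((8 : ℕ) : ℤ))).card =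
    Fintype.card n.Partition := by
  simp only [Finset.card_filter]
  rw [Finset.sum_comm, ← Finset.card_univ, Finset.card_eq_sum_ones]
  apply Finset.sum_congr rfl
  intro p _
  generalize f p = c
  rw [Finset.sum_eq_single (c % 8).toNat]
  · rw [if_pos (by push_cast; omega)]
  · intro b hb hne
    have := Finset.mem_range.1 hb
    rw [if_neg (by push_cast; omega)]
  · intro hh
    exact absurd (Finset.mem_range.2 (by omega)) hh

lemma exists_zeta : ∃ ζ : ℂ, ζ ^ 4 = -1 := by
  obtain ⟨z, hz⟩ := IsAlgClosed.exists_pow_nat_eq (-1 : ℂ) (show 0 < 4 by norm_num)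
  exact ⟨z, hz⟩

lemma crank_symm {n : ℕ} (hn : 2 ≤ n) : (crankCount 7 8 n : ℂ) = crankCount 1 8 n ∧
    (crankCount 6 8 n : ℂ) = crankCount 2 8 n ∧ (crankCount 5 8 n : ℂ) = crankCount 3 8 n := by
  obtain ⟨ζ, hζ⟩ := exists_zeta
  have h0 : ζ ≠ 0 := by rintro rfl; norm_num at hζ
  have key : ∀ z y : ℂ, z * y = 1 → z ^ 8 = 1 →
      ∑ a ∈ Finset.range 8, z ^ a * (crankCount (a : ℤ) 8 n : ℂ) =
      ∑ a ∈ Finset.range 8, y ^ a * (crankCount (a : ℤ) 8 n : ℂ) := by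
    intro z y hzy h8
    have hz : z ≠ 0 := left_ne_zero_of_mul_eq_one hzy
    have hy : y = z⁻¹ := eq_inv_of_mul_eq_one_right hzy
    have h := Cr_symm z hz hn
    rw [Cr_eval z h8, Cr_eval z⁻¹ (by rw [inv_pow, h8, inv_one]), ← hy] at h
    exact h
  have k1 := key ζ (-ζ ^ 3) (by linear_combination -hζ) (by linear_combination (ζ ^ 4 - 1) * hζ)
  have k2 := key (ζ ^ 2) (-ζ ^ 2) (by linear_combination -hζ) (by linear_combination (ζ ^ 12 - ζ ^ 8 + ζ ^ 4 - 1) * hζ)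
  have k3 := key (ζ ^ 3) (-ζ) (by linear_combination -hζ) (by linear_combination (ζ ^ 20 - ζ ^ 16 + ζ ^ 12 - ζ ^ 8 + ζ ^ 4 - 1) * hζ)
  simp only [Finset.sum_range_succ, Finset.sum_range_zero, Nat.cast_zero, Nat.cast_one, Nat.cast_ofNat] at k1 k2 k3
  generalize (crankCount 0 8 n : ℂ) = c0 at *
  generalize (crankCount 1 8 n : ℂ) = c1 at *
  generalize (crankCount 2 8 n : ℂ) = c2 at *
  generalize (crankCount 3 8 n : ℂ) = c3 at *
  generalize (crankCount 4 8 n : ℂ) = c4 at *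
  generalize (crankCount 5 8 n : ℂ) = c5 at *
  generalize (crankCount 6 8 n : ℂ) = c6 at *
  generalize (crankCount 7 8 n : ℂ) = c7 at *
  have e4 : ∀ k, ζ ^ (4 + k) = - ζ ^ k := by intro k; rw [pow_add, hζ]; ring
  have pw : ∀ k, ζ ^ (8 + k) = ζ ^ k := by
    intro k; rw [show 8 + k = 4 + (4 + k) by ring, e4, e4, neg_neg]
  have p4 := e4 0
  have p5 := e4 1
  have p6 := e4 2
  have p7 := e4 3
  have p8 := pw 0
  have p9 := pw 1
  have p10 := pw 2
  have p11 := pw 3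
  have p12 := pw 4
  have p14 := pw 6
  have p15 := pw 7
  have p18 := pw 10
  have p21 := pw 13
  have p13 := pw 5
  simp only [Nat.reduceAdd, pow_zero, pow_one] at p4 p5 p6 p7 p8 p9 p10 p11 p12 p13 p14 p15 p18 p21
  have m1 : (c1 - c7 + (c3 - c5)) * (ζ + ζ ^ 3) + (c2 - c6) * (2 * ζ ^ 2) = 0 := by
    ring_nf at k1 ⊢
    simp only [p4, p5, p6, p7, p8, p9, p10, p11, p12, p13, p14, p15, p18, p21] at k1 ⊢
    linear_combination k1
  have m2 : (c1 - c7 - (c3 - c5)) * (2 * ζ ^ 2) = 0 := by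
    ring_nf at k2 ⊢
    simp only [p4, p5, p6, p7, p8, p9, p10, p11, p12, p13, p14, p15, p18, p21] at k2 ⊢
    linear_combination k2
  have m3 : (c1 - c7 + (c3 - c5)) * (ζ + ζ ^ 3) - (c2 - c6) * (2 * ζ ^ 2) = 0 := by
    ring_nf at k3 ⊢
    simp only [p4, p5, p6, p7, p8, p9, p10, p11, p12, p13, p14, p15, p18, p21] at k3 ⊢
    linear_combination k3
  have hz2 : (2 * ζ ^ 2) ≠ 0 := mul_ne_zero two_ne_zero (pow_ne_zero 2 h0)
  have hs : ζ + ζ ^ 3 ≠ 0 := by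
    intro h
    have : (ζ + ζ ^ 3) ^ 2 = -2 := by linear_combination (ζ ^ 2 + 2) * hζ
    rw [h] at this; norm_num at this
  have q1 := (mul_eq_zero.1 m2).resolve_right hz2
  have q2 : (c1 - c7 + (c3 - c5)) * (ζ + ζ ^ 3) = 0 := by linear_combination (m1 + m3) / 2
  have q3 := (mul_eq_zero.1 q2).resolve_right hs
  have q4 : (c2 - c6) * (2 * ζ ^ 2) = 0 := by linear_combination (m1 - m3) / 2
  have q5 := (mul_eq_zero.1 q4).resolve_right hz2
  refine ⟨?_, ?_, ?_⟩
  · linear_combination -(q1 + q3) / 2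
  · linear_combination -q5
  · linear_combination (q1 - q3) / 2

end FinalPart
section FinalPart2
open PowerSeries Filter Topology
open scoped PowerSeries.WithPiTopology

lemma sig_four (z t : ℂ) (hz : z ≠ 0) (ht : z + z⁻¹ = t) (h2 : t ^ 2 = 2) (m : ℕ) :
    sig z (m + 4) = - sig z m := by
  have a := sig_rec z hz m
  have b := sig_rec z hz (m + 1)
  have c := sig_rec z hz (m + 2)
  rw [ht] at a b c
  simp only [Nat.add_assoc, Nat.reduceAdd] at a b c
  linear_combination -c - t * b - (t ^ 2 - 1) * a + (t * sig z (m + 1) - sig z m) * h2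

lemma sig_eight (z t : ℂ) (hz : z ≠ 0) (ht : z + z⁻¹ = t) (h2 : t ^ 2 = 2) (r q : ℕ) :
    sig z (8 * q + r) = sig z r := by
  induction q with
  | zero => simp
  | succ q ih =>
    rw [show 8 * (q + 1) + r = 8 * q + r + 4 + 4 by ring, sig_four z t hz ht h2,
      sig_four z t hz ht h2, neg_neg, ih]

lemma sig_one_val (z t : ℂ) (ht : z + z⁻¹ = t) : sig z 1 = 1 + t := by
  rw [← ht]; simp [sig]; ring

lemma sig_two_val (z t : ℂ) (hz : z ≠ 0) (ht : z + z⁻¹ = t) (h2 : t ^ 2 = 2) : sig z 2 = 1 + t := by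
  have a := sig_rec z hz 0
  rw [ht, sig_one_val z t ht] at a
  have : sig z 0 = 1 := by simp [sig]
  rw [this] at a
  simp only [Nat.zero_add] at a
  linear_combination -a + h2

lemma tri_mod (m : ℕ) (h : m * (m + 1) / 2 % 4 = 1) : m % 8 = 1 ∨ m % 8 = 6 := by
  obtain ⟨q, r, hr, rfl⟩ : ∃ q r, r < 8 ∧ m = 8 * q + r := ⟨m / 8, m % 8, by omega, by omega⟩
  have e : (8 * q + r) * (8 * q + r + 1) = 8 * (q * (8 * q + 2 * r + 1)) + r * (r + 1) := by ring
  rw [e] at h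
  generalize q * (8 * q + 2 * r + 1) = w at h
  interval_cases r <;> simp at h ⊢ <;> omega

lemma crank_G {n : ℕ} (hn : 2 ≤ n) (h4 : n % 4 = 1) :
    (crankCount 0 8 n : ℂ) + crankCount 1 8 n = crankCount 3 8 n + crankCount 4 8 n := by
  obtain ⟨ζ, hζ⟩ := exists_zeta
  have h0 : ζ ≠ 0 := by rintro rfl; norm_num at hζ
  have h03 : ζ ^ 3 ≠ 0 := pow_ne_zero 3 h0
  have i1 : ζ⁻¹ = -ζ ^ 3 := (eq_inv_of_mul_eq_one_right (by linear_combination -hζ)).symm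
  have i3 : (ζ ^ 3)⁻¹ = -ζ := (eq_inv_of_mul_eq_one_right (by linear_combination -hζ)).symm
  obtain ⟨s, hs⟩ : ∃ s, s = ζ - ζ ^ 3 := ⟨_, rfl⟩
  have s2 : s ^ 2 = 2 := by rw [hs]; linear_combination (ζ ^ 2 - 2) * hζ
  have hs0 : s ≠ 0 := by rintro rfl; norm_num at s2
  have t1 : ζ + ζ⁻¹ = s := by rw [i1, hs]; ring
  have t3 : ζ ^ 3 + (ζ ^ 3)⁻¹ = -s := by rw [i3, hs]; ring
  have s2' : (-s) ^ 2 = 2 := by rw [neg_sq, s2]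
  have K : (Ph ζ * Ph ζ⁻¹) * (Ph (ζ ^ 3) * Ph (ζ ^ 3)⁻¹) = expand 4 four_ne_zero (Ph (-1)) := by
    have e1 := Ph_mul_neg ζ
    have e2 := Ph_mul_neg (ζ ^ 3)
    have e3 := Ph_mul_neg (ζ ^ 2)
    rw [show (ζ ^ 3) ^ 2 = -ζ ^ 2 by linear_combination ζ ^ 2 * hζ] at e2
    rw [show (ζ ^ 2) ^ 2 = -1 by linear_combination hζ] at e3
    rw [expand4, ← e3, map_mul, ← e1, ← e2, i1, i3]
    ring
  have j1 := jtp ζ h0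
  have j3 := jtp (ζ ^ 3) h03
  have c1 := Cr_mul ζ h0
  have c3 := Cr_mul (ζ ^ 3) h03
  obtain ⟨g1, hg1⟩ : ∃ g, g = Cr ζ - (X - C ζ * X) := ⟨_, rfl⟩
  obtain ⟨g3, hg3⟩ : ∃ g, g = Cr (ζ ^ 3) - (X - C (ζ ^ 3) * X) := ⟨_, rfl⟩
  rw [← hg1] at c1
  rw [← hg3] at c3
  have k1 : g1 * expand 4 four_ne_zero (Ph (-1)) = tri (fun n => (-1) ^ n * sig (ζ ^ 3) n) := by
    rw [← K, ← j3, ← c1]; ring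
  have k3 : g3 * expand 4 four_ne_zero (Ph (-1)) = tri (fun n => (-1) ^ n * sig ζ n) := by
    rw [← K, ← j1, ← c3]; ring
  have inv : expand 4 four_ne_zero (Ph (-1)) * expand 4 four_ne_zero (gfW fun _ => (-1 : ℂ)) = 1 := by
    rw [← map_mul, mul_comm]
    have := gfW_mul (fun _ => (-1 : ℂ))
    rw [show Ph (-1) = phW (fun _ => (-1 : ℂ)) from rfl, this, map_one]
  have r1 : g1 = tri (fun n => (-1) ^ n * sig (ζ ^ 3) n) * expand 4 four_ne_zero (gfW fun _ => (-1 : ℂ)) := by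
    rw [← k1, mul_assoc, inv, mul_one]
  have r3 : g3 = tri (fun n => (-1) ^ n * sig ζ n) * expand 4 four_ne_zero (gfW fun _ => (-1 : ℂ)) := by
    rw [← k3, mul_assoc, inv, mul_one]
  have D : (s + 1) * coeff n g1 + (s - 1) * coeff n g3 = 0 := by
    rw [r1, r3, coeff_tri_mul, coeff_tri_mul, Finset.mul_sum, Finset.mul_sum, ← Finset.sum_add_distrib]
    apply Finset.sum_eq_zero
    intro m _
    split_ifs with hm
    · rw [coeff_expand]
      split_ifs with hd
      · have hm4 : m * (m + 1) / 2 % 4 = 1 := by omega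
        have key : (s + 1) * sig (ζ ^ 3) m + (s - 1) * sig ζ m = 0 := by
          rcases tri_mod m hm4 with h | h
          · rw [show m = 8 * (m / 8) + 1 by omega, sig_eight _ _ h03 t3 s2', sig_eight _ _ h0 t1 s2,
              sig_one_val _ _ t1, sig_one_val _ _ t3]
            ring
          · rw [show m = 8 * (m / 8) + (2 + 4) by omega, sig_eight _ _ h03 t3 s2', sig_eight _ _ h0 t1 s2,
              sig_four _ _ h03 t3 s2', sig_four _ _ h0 t1 s2,
              sig_two_val _ _ h0 t1 s2, sig_two_val _ _ h03 t3 s2']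
            ring
        linear_combination ((-1) ^ m * coeff ((n - m * (m + 1) / 2) / 4) (gfW fun _ => (-1 : ℂ))) * key
      · ring
    · ring
  have v1 : coeff n g1 = coeff n (Cr ζ) := by rw [hg1, map_sub, coeff_lin _ hn, sub_zero]
  have v3 : coeff n g3 = coeff n (Cr (ζ ^ 3)) := by rw [hg3, map_sub, coeff_lin _ hn, sub_zero]
  rw [v1, v3, Cr_eval ζ (by linear_combination (ζ ^ 4 - 1) * hζ), Cr_eval (ζ ^ 3) (by
    linear_combination (ζ ^ 20 - ζ ^ 16 + ζ ^ 12 - ζ ^ 8 + ζ ^ 4 - 1) * hζ)] at D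
  obtain ⟨y7, y6, y5⟩ := crank_symm hn
  simp only [Finset.sum_range_succ, Finset.sum_range_zero, Nat.cast_zero, Nat.cast_one, Nat.cast_ofNat,
    y7, y6, y5] at D
  generalize (crankCount 0 8 n : ℂ) = c0 at *
  generalize (crankCount 1 8 n : ℂ) = c1 at *
  generalize (crankCount 2 8 n : ℂ) = c2 at *
  generalize (crankCount 3 8 n : ℂ) = c3 at *
  generalize (crankCount 4 8 n : ℂ) = c4 at *
  have z4 : ∀ k, ζ ^ (4 + k) = - ζ ^ k := by intro k; rw [pow_add, hζ]; ring
  have u1 : ∀ w : ℂ, w ^ 4 = -1 → 0 + w ^ 0 * c0 + w ^ 1 * c1 + w ^ 2 * c2 + w ^ 3 * c3 + w ^ 4 * c4 + w ^ 5 * c3 +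
      w ^ 6 * c2 + w ^ 7 * c1 = (c0 - c4) + (w - w ^ 3) * (c1 - c3) := by
    intro w hw
    linear_combination (c4 + w * c3 + w ^ 2 * c2 + w ^ 3 * c1) * hw
  have w3 : (ζ ^ 3) ^ 4 = -1 := by linear_combination (ζ ^ 8 - ζ ^ 4 + 1) * hζ
  rw [u1 _ hζ, u1 _ w3, ← hs, show ζ ^ 3 - (ζ ^ 3) ^ 3 = -s by
    rw [hs]; linear_combination (-ζ ^ 5 + ζ) * hζ] at D
  have : (2 * s) * ((c0 + c1) - (c3 + c4)) = 0 := by linear_combination D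
  have := (mul_eq_zero.1 this).resolve_left (mul_ne_zero two_ne_zero hs0)
  linear_combination this

lemma crank_H {n : ℕ} (hn : 2 ≤ n) (h4 : n % 4 = 1) :
    (crankCount 0 8 n : ℂ) - 2 * crankCount 2 8 n + crankCount 4 8 n = -((rr 0 n - rr 4 n : ℤ) : ℂ) := by
  have hI : Complex.I ≠ 0 := Complex.I_ne_zero
  have h := Cr_mul Complex.I hI
  rw [Complex.inv_I] at h
  have h2 := rank_crank_I _ h n h4
  rw [← h2, map_sub, coeff_lin _ hn, sub_zero, Cr_eval Complex.I (by
    rw [show (8 : ℕ) = 4 * 2 by norm_num, pow_mul, Complex.I_pow_four, one_pow])]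
  obtain ⟨y7, y6, y5⟩ := crank_symm hn
  simp only [Finset.sum_range_succ, Finset.sum_range_zero, Nat.cast_zero, Nat.cast_one, Nat.cast_ofNat,
    y7, y6, y5]
  have hI2 := Complex.I_sq
  generalize (crankCount 0 8 n : ℂ) = c0 at *
  generalize (crankCount 1 8 n : ℂ) = c1 at *
  generalize (crankCount 2 8 n : ℂ) = c2 at *
  generalize (crankCount 3 8 n : ℂ) = c3 at *
  generalize (crankCount 4 8 n : ℂ) = c4 at *
  generalize Complex.I = w at *
  linear_combination (-c2 - c3 * w - c4 * (w ^ 2 - 1) - c3 * (w ^ 3 - w) - c2 * (w ^ 4 - w ^ 2 + 1) - c1 * (w ^ 5 - w ^ 3 + w)) * hI2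

theorem stmt_15 : ∀ n : ℕ,
    crankCount 0 8 (4 * n + 1) + crankCount 1 8 (4 * n + 1) =
      crankCount 3 8 (4 * n + 1) + crankCount 4 8 (4 * n + 1) ∧
    crankCount 3 8 (4 * n + 1) + crankCount 4 8 (4 * n + 1) =
      rankCount 1 8 (4 * n + 1) + rankCount 2 8 (4 * n + 1) ∧
    rankCount 1 8 (4 * n + 1) + rankCount 2 8 (4 * n + 1) =
      rankCount 3 8 (4 * n + 1) + rankCount 4 8 (4 * n + 1) := by
  intro n
  rcases Nat.eq_zero_or_pos n with rfl | hpos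
  · have e : Multiset.filter (fun x => 1 < x) ({1} : Multiset ℕ) = 0 := by decide
    simp [crankCount, rankCount, partitionCrank, partitionRank, e]
  obtain ⟨m, hm⟩ : ∃ m, m = 4 * n + 1 := ⟨_, rfl⟩
  rw [← hm]
  have hm2 : 2 ≤ m := by omega
  have hm4 : m % 4 = 1 := by omega
  have G := crank_G hm2 hm4
  have H := crank_H hm2 hm4
  obtain ⟨y7, y6, y5⟩ := crank_symm hm2
  have F := (rank_F m m le_rfl).1 (by omega)
  have tc := total_count (n := m) partitionCrank
  have tr := total_count (n := m) partitionRank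
  have dc : ∀ a : ℕ, (Finset.univ.filter (fun p : m.Partition => partitionCrank p % ((8 : ℕ) : ℤ) = (a : ℤ) % ((8 : ℕ) : ℤ))).card = crankCount a 8 m := fun a => rfl
  have dr : ∀ a : ℕ, (Finset.univ.filter (fun p : m.Partition => partitionRank p % ((8 : ℕ) : ℤ) = (a : ℤ) % ((8 : ℕ) : ℤ))).card = rankCount a 8 m := fun a => rfl
  simp only [dc] at tc
  simp only [dr] at tr
  simp only [Finset.sum_range_succ, Finset.sum_range_zero, Nat.cast_zero, Nat.cast_one, Nat.cast_ofNat] at tc tr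
  have er : ∀ a : ℤ, rr a m = rankCount a 8 m := by
    intro a; rw [rr, if_pos (by omega), Int.toNat_natCast]
  have s5 := rr5 m
  have s6 := rr6 m
  have s7 := rr7 m
  rw [er, er] at s5 s6 s7
  rw [er, er, er, er] at F
  rw [er, er] at H
  norm_cast at G y7 y6 y5
  have H' : (crankCount 0 8 m : ℤ) - 2 * crankCount 2 8 m + crankCount 4 8 m =
      -((rankCount 0 8 m : ℤ) - rankCount 4 8 m) := by
    exact_mod_cast H
  omega
end FinalPart2
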